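/- Fix indices 1 ≤ i ≤ j ≤ l ≤ n−1, an index 1 ≤ m ≤ l, and an integer p. For γ_m ∈ {X_m, e_m} one has γ_m·α_{ijl}^p ∈ ⟨α_{i'j'l}^{p'}·b : 1 ≤ i' ≤ j' ≤ l, b ∈ B_{l−1}, i' ≥ min(i,m), |p'| ≤ |p|, and p'p ≥ 0 unless i' = m⟩. -/

import Mathlib

/-!
Cyclotomic BMW algebra `B_n^k(R)`, presented as the quotient of the free `R`-algebra on
generators `Y, Y⁻¹, Xᵢ, Xᵢ⁻¹ (1 ≤ i ≤ n-1), eᵢ (1 ≤ i ≤ n-1)` by the defining relations.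
Generators with out-of-range indices are identified with `1` (resp. `0` for the `eᵢ`),
so that the quotient is exactly the cyclotomic BMW algebra.
-/

inductive BMWGen : Type
  | Y : BMWGen
  | Yinv : BMWGen
  | X : ℕ → BMWGen
  | Xinv : ℕ → BMWGen
  | E : ℕ → BMWGen

namespace CBMW

/-- The parameters of a cyclotomic BMW algebra: `n`, `k`, units `q, λ, q₀` and
families `qc` (the `qᵢ`, with `qc 0 = q₀`) and `A` (the `Aᵢ`). -/
structure Params (R : Type) [CommRing R] where
  n : ℕ
  k : ℕ
  q : Rˣ
  lam : Rˣ
  q0 : Rˣ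
  qc : ℕ → R
  A : ℕ → R

variable {R : Type} [CommRing R]

abbrev F (R : Type) [CommRing R] := FreeAlgebra R BMWGen

def fY : F R := FreeAlgebra.ι R BMWGen.Y
def fYi : F R := FreeAlgebra.ι R BMWGen.Yinv
def fX (i : ℕ) : F R := FreeAlgebra.ι R (BMWGen.X i)
def fXi (i : ℕ) : F R := FreeAlgebra.ι R (BMWGen.Xinv i)
def fE (i : ℕ) : F R := FreeAlgebra.ι R (BMWGen.E i)

/-- `δ = q - q⁻¹`. -/
def Params.delta (P : Params R) : R := (P.q : R) - ((P.q⁻¹ : Rˣ) : R)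

/-- `λ⁻¹` as an element of `R`. -/
def Params.laminv (P : Params R) : R := ((P.lam⁻¹ : Rˣ) : R)

/-- The defining relations of the cyclotomic BMW algebra. -/
inductive Rel (P : Params R) : F R → F R → Prop
  | X_inv_right {i : ℕ} (h1 : 1 ≤ i) (h2 : i ≤ P.n - 1) : Rel P (fX i * fXi i) 1
  | X_inv_left {i : ℕ} (h1 : 1 ≤ i) (h2 : i ≤ P.n - 1) : Rel P (fXi i * fX i) 1
  | Y_inv_right : Rel P (fY * fYi) 1
  | Y_inv_left : Rel P (fYi * fY) 1
  | X_invalid {i : ℕ} (h : i = 0 ∨ P.n - 1 < i) : Rel P (fX i) 1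
  | Xi_invalid {i : ℕ} (h : i = 0 ∨ P.n - 1 < i) : Rel P (fXi i) 1
  | E_invalid {i : ℕ} (h : i = 0 ∨ P.n - 1 < i) : Rel P (fE i) 0
  | skein {i : ℕ} (h1 : 1 ≤ i) (h2 : i ≤ P.n - 1) :
      Rel P (fX i - fXi i) (P.delta • ((1 : F R) - fE i))
  | XX_far {i j : ℕ} (h1 : 1 ≤ i) (h2 : i ≤ P.n - 1) (h3 : 1 ≤ j) (h4 : j ≤ P.n - 1)
      (h : i + 2 ≤ j ∨ j + 2 ≤ i) : Rel P (fX i * fX j) (fX j * fX i)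
  | braid {i : ℕ} (h1 : 1 ≤ i) (h2 : i + 1 ≤ P.n - 1) :
      Rel P (fX i * fX (i+1) * fX i) (fX (i+1) * fX i * fX (i+1))
  | XE_far {i j : ℕ} (h1 : 1 ≤ i) (h2 : i ≤ P.n - 1) (h3 : 1 ≤ j) (h4 : j ≤ P.n - 1)
      (h : i + 2 ≤ j ∨ j + 2 ≤ i) : Rel P (fX i * fE j) (fE j * fX i)
  | EE_far {i j : ℕ} (h1 : 1 ≤ i) (h2 : i ≤ P.n - 1) (h3 : 1 ≤ j) (h4 : j ≤ P.n - 1)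
      (h : i + 2 ≤ j ∨ j + 2 ≤ i) : Rel P (fE i * fE j) (fE j * fE i)
  | untwist_right {i : ℕ} (h1 : 1 ≤ i) (h2 : i ≤ P.n - 1) :
      Rel P (fX i * fE i) ((P.lam : R) • fE i)
  | untwist_left {i : ℕ} (h1 : 1 ≤ i) (h2 : i ≤ P.n - 1) :
      Rel P (fE i * fX i) ((P.lam : R) • fE i)
  | XXE {i j : ℕ} (h1 : 1 ≤ i) (h2 : i ≤ P.n - 1) (h3 : 1 ≤ j) (h4 : j ≤ P.n - 1)
      (h : j = i + 1 ∨ i = j + 1) : Rel P (fX i * fX j * fE i) (fE j * fE i)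
  | EXX {i j : ℕ} (h1 : 1 ≤ i) (h2 : i ≤ P.n - 1) (h3 : 1 ≤ j) (h4 : j ≤ P.n - 1)
      (h : j = i + 1 ∨ i = j + 1) : Rel P (fE j * fE i) (fE j * fX i * fX j)
  | EEE_up {i : ℕ} (h1 : 1 ≤ i) (h2 : i + 1 ≤ P.n - 1) :
      Rel P (fE i * fE (i+1) * fE i) (fE i)
  | EEE_down {i : ℕ} (h1 : 1 ≤ i) (h2 : i + 1 ≤ P.n - 1) :
      Rel P (fE (i+1) * fE i * fE (i+1)) (fE (i+1))
  | E_sq {i : ℕ} (h1 : 1 ≤ i) (h2 : i ≤ P.n - 1) : Rel P (fE i * fE i) (P.A 0 • fE i)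
  | cyclo : Rel P (fY ^ P.k) (∑ i ∈ Finset.range P.k, P.qc i • fY ^ i)
  | braidB (h : 2 ≤ P.n) :
      Rel P (fX 1 * fY * fX 1 * fY) (fY * fX 1 * fY * fX 1)
  | YX_comm {i : ℕ} (h1 : 2 ≤ i) (h2 : i ≤ P.n - 1) : Rel P (fY * fX i) (fX i * fY)
  | YE_comm {i : ℕ} (h1 : 2 ≤ i) (h2 : i ≤ P.n - 1) : Rel P (fY * fE i) (fE i * fY)
  | YXYE (h : 2 ≤ P.n) : Rel P (fY * fX 1 * fY * fE 1) (P.laminv • fE 1)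
  | EYXY (h : 2 ≤ P.n) : Rel P (fE 1 * (fY * fX 1 * fY)) (P.laminv • fE 1)
  | EYE {m : ℕ} (h : 2 ≤ P.n) (hm : m ≤ P.k - 1) :
      Rel P (fE 1 * fY ^ m * fE 1) (P.A m • fE 1)

/-- The cyclotomic BMW algebra `B_n^k(R)`. -/
abbrev Alg (P : Params R) := RingQuot (Rel P)

def pr (P : Params R) : F R →ₐ[R] Alg P := RingQuot.mkAlgHom R (Rel P)

/-- The generator `Y`. -/
def Yg (P : Params R) : Alg P := pr P fY
/-- The generator `Y⁻¹`. -/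
def Ygi (P : Params R) : Alg P := pr P fYi
/-- The generator `Xᵢ`. -/
def Xg (P : Params R) (i : ℕ) : Alg P := pr P (fX i)
/-- The generator `Xᵢ⁻¹`. -/
def Xgi (P : Params R) (i : ℕ) : Alg P := pr P (fXi i)
/-- The generator `eᵢ`. -/
def Eg (P : Params R) (i : ℕ) : Alg P := pr P (fE i)

/-- `X₁ X₂ ⋯ X_m`. -/
def upX (P : Params R) : ℕ → Alg P
  | 0 => 1
  | m + 1 => upX P m * Xg P (m + 1)

/-- `X_m ⋯ X₂ X₁`. -/
def downX (P : Params R) : ℕ → Alg P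
  | 0 => 1
  | m + 1 => Xg P (m + 1) * downX P m

/-- `X₁⁻¹ X₂⁻¹ ⋯ X_m⁻¹`. -/
def upXi (P : Params R) : ℕ → Alg P
  | 0 => 1
  | m + 1 => upXi P m * Xgi P (m + 1)

/-- `X_m⁻¹ ⋯ X₂⁻¹ X₁⁻¹`. -/
def downXi (P : Params R) : ℕ → Alg P
  | 0 => 1
  | m + 1 => Xgi P (m + 1) * downXi P m

/-- `Yᵢ' = X_{i-1} ⋯ X₁ Y X₁ ⋯ X_{i-1}`. -/
def Yp (P : Params R) (i : ℕ) : Alg P := downX P (i - 1) * Yg P * upX P (i - 1)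

/-- `(Yᵢ')⁻¹ = X_{i-1}⁻¹ ⋯ X₁⁻¹ Y⁻¹ X₁⁻¹ ⋯ X_{i-1}⁻¹`. -/
def YpInv (P : Params R) (i : ℕ) : Alg P := downXi P (i - 1) * Ygi P * upXi P (i - 1)

/-- `(Yᵢ')^p` for an integer exponent `p`. -/
def Ypow (P : Params R) (i : ℕ) (p : ℤ) : Alg P :=
  if 0 ≤ p then Yp P i ^ p.toNat else YpInv P i ^ (-p).toNat

/-- `Y^{s 1} (Y₂')^{s 2} ⋯ (Y_m')^{s m}`. -/
def YpowProd (P : Params R) (s : ℕ → ℤ) : ℕ → Alg P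
  | 0 => 1
  | m + 1 => YpowProd P s m * Ypow P (m + 1) (s (m + 1))

/-- The subalgebra `B_l` generated by `Y^{±1}, X₁^{±1}, …, X_{l-1}^{±1}, e₁, …, e_{l-1}`. -/
def Bsub (P : Params R) (l : ℕ) : Subalgebra R (Alg P) :=
  Algebra.adjoin R
    ({Yg P, Ygi P} ∪
      {x | ∃ i, 1 ≤ i ∧ i + 1 ≤ l ∧ (x = Xg P i ∨ x = Xgi P i ∨ x = Eg P i)})

/-- `α_{ijl}^p = (Yᵢ')^p Xᵢ ⋯ X_{j-1} e_j ⋯ e_l`. -/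
def alpha (P : Params R) (i j l : ℕ) (p : ℤ) : Alg P :=
  Ypow P i p * ((List.range' i (j - i)).map fun t => Xg P t).prod *
    ((List.range' j (l + 1 - j)).map fun t => Eg P t).prod

/-- The set `P = {⌊k/2⌋ - (k-1), …, ⌊k/2⌋}` of `k` consecutive integers. -/
def Pset (k : ℕ) : Set ℤ := {p | (↑(k / 2) : ℤ) - ((k : ℤ) - 1) ≤ p ∧ p ≤ (↑(k / 2) : ℤ)}

/-- `α_{i₁,j₁,l-1}^{s₁} ⋯ α_{i_m,j_m,l-2m+1}^{s_m}`. -/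
def alphaChain (P : Params R) (l : ℕ) (ii jj : ℕ → ℕ) (ss : ℕ → ℤ) : ℕ → Alg P
  | 0 => 1
  | m + 1 => alphaChain P l ii jj ss m *
      alpha P (ii (m + 1)) (jj (m + 1)) (l + 1 - 2 * (m + 1)) (ss (m + 1))

/-- `α_{i₁,j₁,l-2}^{s₁} ⋯ α_{i_m,j_m,l-2m}^{s_m}`. -/
def alphaChainBar (P : Params R) (l : ℕ) (ii jj : ℕ → ℕ) (ss : ℕ → ℤ) : ℕ → Alg P
  | 0 => 1
  | m + 1 => alphaChainBar P l ii jj ss m *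
      alpha P (ii (m + 1)) (jj (m + 1)) (l - 2 * (m + 1)) (ss (m + 1))

/-- `E_{l,m} = e_{l-1} e_{l-3} ⋯ e_{l-2m+1}`. -/
def Echain (P : Params R) (l : ℕ) : ℕ → Alg P
  | 0 => 1
  | m + 1 => Echain P l m * Eg P (l + 1 - 2 * (m + 1))

/-- The set `V_{l,m}^g`. -/
def Vg (P : Params R) (l m : ℕ) : Set (Alg P) :=
  {x | ∃ ii jj : ℕ → ℕ, ∃ ss : ℕ → ℤ,
    (∀ t, 1 ≤ t → t ≤ m →
      1 ≤ ii t ∧ ii t ≤ jj t ∧ jj t ≤ l + 1 - 2 * t ∧ ss t ∈ Pset P.k) ∧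
    x = alphaChain P l ii jj ss m}

/-- The set `V_{l,m}`. -/
def V (P : Params R) (l m : ℕ) : Set (Alg P) :=
  {x | ∃ ii jj : ℕ → ℕ, ∃ ss : ℕ → ℤ,
    (∀ t, 1 ≤ t → t ≤ m →
      1 ≤ ii t ∧ ii t ≤ jj t ∧ jj t ≤ l + 1 - 2 * t ∧ ss t ∈ Pset P.k) ∧
    (∀ t, 1 ≤ t → t + 1 ≤ m → ii (t + 1) < ii t) ∧
    x = alphaChain P l ii jj ss m}

/-- The set `V̄_{l,m}`. -/
def Vbar (P : Params R) (l m : ℕ) : Set (Alg P) :=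
  {x | ∃ ii jj : ℕ → ℕ, ∃ ss : ℕ → ℤ,
    (∀ t, 1 ≤ t → t ≤ m →
      1 ≤ ii t ∧ ii t ≤ jj t ∧ jj t ≤ l + 1 - 2 * t ∧ ss t ∈ Pset P.k) ∧
    (∀ t, 1 ≤ t → t + 1 ≤ m → ii (t + 1) < ii t) ∧
    x = alphaChainBar P l ii jj ss m}

end CBMW

open CBMW

/-- Two neighbouring strands of the affine BMW algebra: the crossing `X`, the cup-cap `e` and the
Jucys-Murphy elements `y`, `z = X y X` of the two strands, together with a subalgebra `W` of
coefficients in which the loops `e y^c e` take values. -/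
structure StrandPair (R A : Type*) [CommRing R] [Ring A] [Algebra R A] where
  X : Aˣ
  y : Aˣ
  z : Aˣ
  e : A
  δ : R
  lam : Rˣ
  W : Subalgebra R A
  skein : (X : A) - (X⁻¹ : Aˣ) = δ • (1 - e)
  X_e : (X : A) * e = (lam : R) • e
  e_X : e * (X : A) = (lam : R) • e
  z_eq : z = X * y * X
  comm : Commute y z
  yz_e : ((y * z : Aˣ) : A) * e = e
  e_yz : e * ((y * z : Aˣ) : A) = e
  W_e : ∀ w ∈ W, Commute w e
  W_y : ∀ w ∈ W, Commute w (y : A)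
  W_z : ∀ w ∈ W, Commute w (z : A)
  loop : ∀ c : ℤ, ∃ w ∈ W, e * ((y ^ c : Aˣ) : A) * e = e * w

namespace StrandPair

variable {R A : Type*} [CommRing R] [Ring A] [Algebra R A] (S : StrandPair R A)

lemma inv_mul_of_mul_eq_smul {u : Aˣ} {x : A} {c : Rˣ} (h : (u : A) * x = (c : R) • x) :
    ((u⁻¹ : Aˣ) : A) * x = ((c⁻¹ : Rˣ) : R) • x := by
  have h' : ((u⁻¹ : Aˣ) : A) * ((c : R) • x) = x := by rw [← h, Units.inv_mul_cancel_left]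
  rw [mul_smul_comm] at h'
  nth_rewrite 2 [← h']
  rw [smul_smul, Units.inv_mul, one_smul]

lemma mul_inv_of_mul_eq_smul {u : Aˣ} {x : A} {c : Rˣ} (h : x * (u : A) = (c : R) • x) :
    x * ((u⁻¹ : Aˣ) : A) = ((c⁻¹ : Rˣ) : R) • x := by
  have h' : ((c : R) • x) * ((u⁻¹ : Aˣ) : A) = x := by rw [← h, Units.mul_inv_cancel_right]
  rw [smul_mul_assoc] at h'
  nth_rewrite 2 [← h']
  rw [smul_smul, Units.inv_mul, one_smul]

lemma zpow_mul_of_mul_eq {u : Aˣ} {x : A} (h : (u : A) * x = x) (c : ℤ) :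
    ((u ^ c : Aˣ) : A) * x = x := by
  have h' : ((u⁻¹ : Aˣ) : A) * x = x := by rw [Units.inv_mul_eq_iff_eq_mul, h]
  induction c using Int.induction_on with
  | zero => simp
  | succ n ih => rw [zpow_add_one, Units.val_mul, mul_assoc, h, ih]
  | pred n ih => rw [zpow_sub_one, Units.val_mul, mul_assoc, h', ih]

lemma mul_zpow_of_mul_eq {u : Aˣ} {x : A} (h : x * (u : A) = x) (c : ℤ) :
    x * ((u ^ c : Aˣ) : A) = x := by
  have h' : x * ((u⁻¹ : Aˣ) : A) = x := by rw [Units.mul_inv_eq_iff_eq_mul, h]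
  induction c using Int.induction_on with
  | zero => simp
  | succ n ih => rw [zpow_add_one, Units.val_mul, ← mul_assoc, ih, h]
  | pred n ih => rw [zpow_sub_one, Units.val_mul, ← mul_assoc, ih, h']

/-- Reversing all crossings. -/
def flip : StrandPair R A where
  X := S.X⁻¹
  y := S.y⁻¹
  z := S.z⁻¹
  e := S.e
  δ := -S.δ
  lam := S.lam⁻¹
  W := S.W
  skein := by
    rw [inv_inv, neg_smul, ← S.skein, neg_sub]
  X_e := inv_mul_of_mul_eq_smul S.X_e
  e_X := mul_inv_of_mul_eq_smul S.e_X
  z_eq := by rw [S.z_eq]; group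
  comm := S.comm.inv_inv
  yz_e := by
    have := zpow_mul_of_mul_eq S.yz_e (-1)
    rwa [zpow_neg_one, S.comm.eq, mul_inv_rev] at this
  e_yz := by
    have := mul_zpow_of_mul_eq S.e_yz (-1)
    rwa [zpow_neg_one, S.comm.eq, mul_inv_rev] at this
  W_e := S.W_e
  W_y w hw := (S.W_y w hw).units_inv_right
  W_z w hw := (S.W_z w hw).units_inv_right
  loop c := by
    obtain ⟨w, hw, h⟩ := S.loop (-c)
    exact ⟨w, hw, by rwa [inv_zpow']⟩

lemma z_zpow_mul_e (c : ℤ) :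
    ((S.z ^ c : Aˣ) : A) * S.e = ((S.y ^ (-c) : Aˣ) : A) * S.e := by
  have := zpow_mul_of_mul_eq S.yz_e c
  rw [S.comm.mul_zpow, Units.val_mul, mul_assoc] at this
  rw [zpow_neg, eq_comm, Units.inv_mul_eq_iff_eq_mul, this]

lemma e_mul_z_zpow (c : ℤ) :
    S.e * ((S.z ^ c : Aˣ) : A) = S.e * ((S.y ^ (-c) : Aˣ) : A) := by
  have := mul_zpow_of_mul_eq S.e_yz c
  rw [S.comm.mul_zpow, (S.comm.zpow_zpow c c).eq, Units.val_mul, ← mul_assoc] at this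
  rw [zpow_neg, eq_comm, Units.mul_inv_eq_iff_eq_mul, this]

lemma X_eq : (S.X : A) = ((S.X⁻¹ : Aˣ) : A) + S.δ • 1 - S.δ • S.e := by
  rw [add_sub_assoc, ← smul_sub, ← S.skein]; abel

lemma X_inv_eq : ((S.X⁻¹ : Aˣ) : A) = (S.X : A) - S.δ • 1 + S.δ • S.e := by
  rw [S.X_eq]; abel

lemma X_inv_mul_z : ((S.X⁻¹ : Aˣ) : A) * S.z = S.y * S.X := by
  rw [S.z_eq]; simp [mul_assoc]

lemma z_mul_X_inv : (S.z : A) * ((S.X⁻¹ : Aˣ) : A) = S.X * S.y := by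
  rw [S.z_eq]; simp [mul_assoc]

lemma zX_eq : (S.z : A) * S.X
    = S.X * S.y + S.δ • (S.z : A) - S.δ • (((S.y ^ (-1 : ℤ) : Aˣ) : A) * S.e) := by
  have h := S.z_zpow_mul_e 1
  rw [zpow_one] at h
  conv_lhs => rw [S.X_eq]
  rw [mul_sub, mul_add, z_mul_X_inv, mul_smul_comm, mul_smul_comm, mul_one, h]

lemma yX_eq : (S.y : A) * S.X = S.X * S.z - S.δ • (S.z : A) + S.δ • (S.e * S.z) := by
  rw [← X_inv_mul_z, X_inv_eq]
  simp [add_mul, sub_mul]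

/-- The span of the elements `z^a y^b`, `y^a X y^b` and `y^a e y^b w` with bounded exponents on the
left; the exponent of `z` is non-negative. -/
def N (s t : ℕ) : Submodule R A := Submodule.span R
  ({x | ∃ a : ℕ, a ≤ s ∧ ∃ b : ℤ, x = ((S.z ^ a : Aˣ) : A) * ((S.y ^ b : Aˣ) : A)} ∪
   {x | ∃ a b : ℤ, |a| ≤ t ∧ x = ((S.y ^ a : Aˣ) : A) * S.X * ((S.y ^ b : Aˣ) : A)} ∪
   {x | ∃ a b : ℤ, |a| ≤ t ∧ ∃ w ∈ S.W,
      x = ((S.y ^ a : Aˣ) : A) * S.e * ((S.y ^ b : Aˣ) : A) * w})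

/-- The span of the elements `e y^b w`. -/
def E : Submodule R A := Submodule.span R
  {x | ∃ b : ℤ, ∃ w ∈ S.W, x = S.e * ((S.y ^ b : Aˣ) : A) * w}

/-- The span of the elements `y^a e w` with `|a| ≤ t`. -/
def G (t : ℕ) : Submodule R A := Submodule.span R
  {x | ∃ a : ℤ, |a| ≤ t ∧ ∃ w ∈ S.W, x = ((S.y ^ a : Aˣ) : A) * S.e * w}

variable {S}

lemma zy_mem_N {s t a : ℕ} (h : a ≤ s) (b : ℤ) :
    ((S.z ^ a : Aˣ) : A) * ((S.y ^ b : Aˣ) : A) ∈ S.N s t :=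
  Submodule.subset_span (.inl (.inl ⟨a, h, b, rfl⟩))

lemma yXy_mem_N {s t : ℕ} {a : ℤ} (h : |a| ≤ t) (b : ℤ) :
    ((S.y ^ a : Aˣ) : A) * S.X * ((S.y ^ b : Aˣ) : A) ∈ S.N s t :=
  Submodule.subset_span (.inl (.inr ⟨a, b, h, rfl⟩))

lemma yey_mem_N {s t : ℕ} {a : ℤ} (h : |a| ≤ t) (b : ℤ) {w : A} (hw : w ∈ S.W) :
    ((S.y ^ a : Aˣ) : A) * S.e * ((S.y ^ b : Aˣ) : A) * w ∈ S.N s t :=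
  Submodule.subset_span (.inr ⟨a, b, h, w, hw, rfl⟩)

lemma ey_mem_E (b : ℤ) {w : A} (hw : w ∈ S.W) : S.e * ((S.y ^ b : Aˣ) : A) * w ∈ S.E :=
  Submodule.subset_span ⟨b, w, hw, rfl⟩

lemma ye_mem_G {t : ℕ} {a : ℤ} (h : |a| ≤ t) {w : A} (hw : w ∈ S.W) :
    ((S.y ^ a : Aˣ) : A) * S.e * w ∈ S.G t :=
  Submodule.subset_span ⟨a, h, w, hw, rfl⟩

lemma E_le_N {s t : ℕ} : S.E ≤ S.N s t := by
  refine Submodule.span_le.2 ?_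
  rintro _ ⟨b, w, hw, rfl⟩
  simpa using yey_mem_N (s := s) (t := t) (a := 0) (by simp) b hw

lemma G_le_N {s t : ℕ} : S.G t ≤ S.N s t := by
  refine Submodule.span_le.2 ?_
  rintro _ ⟨a, ha, w, hw, rfl⟩
  simpa using yey_mem_N (s := s) ha 0 hw

lemma N_mono {s s' t t' : ℕ} (hs : s ≤ s') (ht : t ≤ t') : S.N s t ≤ S.N s' t' := by
  refine Submodule.span_le.2 ?_
  rintro _ ((⟨a, h, b, rfl⟩ | ⟨a, b, h, rfl⟩) | ⟨a, b, h, w, hw, rfl⟩)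
  · exact zy_mem_N (h.trans hs) b
  · exact yXy_mem_N (h.trans (by exact_mod_cast ht)) b
  · exact yey_mem_N (h.trans (by exact_mod_cast ht)) b hw

lemma G_mono {t t' : ℕ} (ht : t ≤ t') : S.G t ≤ S.G t' := by
  refine Submodule.span_le.2 ?_
  rintro _ ⟨a, h, w, hw, rfl⟩
  exact ye_mem_G (h.trans (by exact_mod_cast ht)) hw

lemma mul_mem_of_forall {ι : Set A} {p : Submodule R A} (u : A) (h : ∀ x ∈ ι, u * x ∈ p) {x : A}
    (hx : x ∈ Submodule.span R ι) : u * x ∈ p :=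
  (Submodule.span_le (p := p.comap (LinearMap.mulLeft R u))).2 h hx

lemma mem_mul_of_forall {ι : Set A} {p : Submodule R A} (u : A) (h : ∀ x ∈ ι, x * u ∈ p) {x : A}
    (hx : x ∈ Submodule.span R ι) : x * u ∈ p :=
  (Submodule.span_le (p := p.comap (LinearMap.mulRight R u))).2 h hx

lemma y_mul_mem_N {s t : ℕ} {x : A} (hx : x ∈ S.N s t) : S.y * x ∈ S.N s (t + 1) := by
  refine mul_mem_of_forall _ ?_ hx
  rintro _ ((⟨a, h, b, rfl⟩ | ⟨a, b, h, rfl⟩) | ⟨a, b, h, w, hw, rfl⟩)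
  · rw [← mul_assoc, ← Units.val_mul, (S.comm.pow_right a).eq, Units.val_mul, mul_assoc,
      ← Units.val_mul, ← zpow_one_add]
    exact zy_mem_N h _
  · rw [← mul_assoc, ← mul_assoc, ← Units.val_mul, ← zpow_one_add]
    exact yXy_mem_N (by push_cast; grind) b
  · rw [← mul_assoc, ← mul_assoc, ← mul_assoc, ← Units.val_mul, ← zpow_one_add]
    exact yey_mem_N (by push_cast; grind) b hw

lemma z_pow_mem_N {s t : ℕ} : ((S.z ^ s : Aˣ) : A) ∈ S.N s t := by
  simpa using zy_mem_N (S := S) (t := t) le_rfl 0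

lemma z_mul_y_zpow (a : ℤ) :
    (S.z : A) * ((S.y ^ a : Aˣ) : A) = ((S.y ^ a : Aˣ) : A) * S.z := by
  rw [← Units.val_mul, ← Units.val_mul, (S.comm.zpow_left a).eq]

lemma z_mul_ye (a : ℤ) :
    (S.z : A) * (((S.y ^ a : Aˣ) : A) * S.e) = ((S.y ^ (a - 1) : Aˣ) : A) * S.e := by
  have h := S.z_zpow_mul_e 1
  rw [zpow_one] at h
  rw [← mul_assoc, z_mul_y_zpow, mul_assoc, h, ← mul_assoc, ← Units.val_mul, ← zpow_add,
    sub_eq_add_neg]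

lemma z_mul_mem_N {s t : ℕ} {x : A} (hx : x ∈ S.N s t) : S.z * x ∈ S.N (s + 1) (t + 1) := by
  refine mul_mem_of_forall _ ?_ hx
  rintro _ ((⟨a, h, b, rfl⟩ | ⟨a, b, h, rfl⟩) | ⟨a, b, h, w, hw, rfl⟩)
  · rw [← mul_assoc, ← Units.val_mul, ← pow_succ']
    exact zy_mem_N (by omega) b
  · have key : (S.z : A) * (((S.y ^ a : Aˣ) : A) * S.X * ((S.y ^ b : Aˣ) : A))
        = ((S.y ^ a : Aˣ) : A) * S.X * ((S.y ^ (1 + b) : Aˣ) : A)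
          + S.δ • (((S.z ^ 1 : Aˣ) : A) * ((S.y ^ (a + b) : Aˣ) : A))
          - S.δ • (((S.y ^ (a - 1) : Aˣ) : A) * S.e * ((S.y ^ b : Aˣ) : A) * 1) := by
      rw [← mul_assoc, ← mul_assoc, z_mul_y_zpow, mul_assoc _ (S.z : A), zX_eq, zpow_one_add,
        zpow_add, sub_eq_add_neg a, zpow_add, pow_one, Units.val_mul _ (S.y ^ b),
        Units.val_mul (S.y ^ a) (S.y ^ b), ← mul_assoc (S.z : A), z_mul_y_zpow]
      simp only [mul_sub, sub_mul, mul_add, add_mul, mul_assoc, smul_mul_assoc, mul_smul_comm,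
        Units.val_mul, mul_one]
    rw [key]
    refine sub_mem (add_mem ?_ (Submodule.smul_mem _ _ ?_)) (Submodule.smul_mem _ _ ?_)
    · exact yXy_mem_N (by push_cast; grind) _
    · exact zy_mem_N (by omega) _
    · exact yey_mem_N (by push_cast; grind) b (one_mem _)
  · rw [mul_assoc (_ * S.e), ← mul_assoc, z_mul_ye, ← mul_assoc]
    exact yey_mem_N (by push_cast; grind) b hw

lemma X_mul_z_pow_mem_N (n : ℕ) : (S.X : A) * ((S.z ^ n : Aˣ) : A) ∈ S.N n n := by
  induction n with
  | zero => simpa using yXy_mem_N (S := S) (s := 0) (t := 0) (a := 0) (by simp) 0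
  | succ n ih =>
    have h := S.e_mul_z_zpow (n + 1 : ℕ)
    rw [zpow_natCast] at h
    have key : (S.X : A) * ((S.z ^ (n + 1) : Aˣ) : A) = S.y * (S.X * ((S.z ^ n : Aˣ) : A))
        + S.δ • ((S.z ^ (n + 1) : Aˣ) : A)
        - S.δ • (S.e * ((S.y ^ (-(n + 1 : ℕ) : ℤ) : Aˣ) : A) * 1) := by
      rw [mul_one, ← h, ← mul_assoc (S.y : A), ← X_inv_mul_z]
      conv_lhs => rw [X_eq]
      rw [sub_mul, add_mul, pow_succ', Units.val_mul, smul_mul_assoc, smul_mul_assoc, one_mul,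
        ← mul_assoc]
    rw [key]
    exact sub_mem (add_mem (N_mono n.le_succ le_rfl (y_mul_mem_N ih))
      (Submodule.smul_mem _ _ z_pow_mem_N))
      (Submodule.smul_mem _ _ (E_le_N (ey_mem_E _ (one_mem _))))

lemma E_mul_z_mem {x : A} (hx : x ∈ S.E) : x * S.z ∈ S.E := by
  refine mem_mul_of_forall _ ?_ hx
  rintro _ ⟨b, w, hw, rfl⟩
  have h := S.e_mul_z_zpow 1
  rw [zpow_one] at h
  rw [mul_assoc, (S.W_z w hw).eq, ← mul_assoc, mul_assoc S.e, ← z_mul_y_zpow, ← mul_assoc, h,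
    mul_assoc S.e, ← Units.val_mul, ← zpow_add]
  exact ey_mem_E _ hw

lemma e_y_e_mem_E (c : ℤ) : S.e * ((S.y ^ c : Aˣ) : A) * S.e ∈ S.E := by
  obtain ⟨w, hw, h⟩ := S.loop c
  rw [h]
  simpa using ey_mem_E 0 hw

lemma e_y_mem_E (c : ℤ) : S.e * ((S.y ^ c : Aˣ) : A) ∈ S.E := by
  simpa using ey_mem_E (S := S) c (one_mem _)

lemma e_y_pow_X_mem_E (n : ℕ) : S.e * ((S.y ^ n : Aˣ) : A) * S.X ∈ S.E := by
  induction n with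
  | zero =>
    rw [pow_zero, Units.val_one, mul_one, e_X]
    exact Submodule.smul_mem _ _ (by simpa using e_y_mem_E (S := S) 0)
  | succ n ih =>
    have key : S.e * ((S.y ^ (n + 1) : Aˣ) : A) * S.X
        = S.e * ((S.y ^ n : Aˣ) : A) * S.X * S.z
          - S.δ • (S.e * ((S.y ^ (n : ℤ) : Aˣ) : A) * S.z)
          + S.δ • (S.e * ((S.y ^ (n : ℤ) : Aˣ) : A) * S.e * S.z) := by
      rw [pow_succ, Units.val_mul, mul_assoc, mul_assoc _ (S.y : A), yX_eq]
      simp only [mul_sub, mul_add, mul_assoc, mul_smul_comm, zpow_natCast]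
    rw [key]
    exact add_mem (sub_mem (E_mul_z_mem ih)
      (Submodule.smul_mem _ _ (E_mul_z_mem (e_y_mem_E _))))
      (Submodule.smul_mem _ _ (E_mul_z_mem (e_y_e_mem_E _)))

lemma z_mul_mem_G {t : ℕ} {x : A} (hx : x ∈ S.G t) : S.z * x ∈ S.G (t + 1) := by
  refine mul_mem_of_forall _ ?_ hx
  rintro _ ⟨a, h, w, hw, rfl⟩
  rw [← mul_assoc, z_mul_ye]
  exact ye_mem_G (by push_cast; grind) hw

lemma y_e_mem_G (c : ℤ) : ((S.y ^ c : Aˣ) : A) * S.e ∈ S.G c.natAbs := by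
  simpa using ye_mem_G (S := S) (t := c.natAbs) (a := c) (by simp) (one_mem _)

lemma e_y_e_mem_G (c : ℤ) : S.e * ((S.y ^ c : Aˣ) : A) * S.e ∈ S.G 0 := by
  obtain ⟨w, hw, h⟩ := S.loop c
  rw [h]
  simpa using ye_mem_G (S := S) (t := 0) (a := 0) (by simp) hw

lemma Xy_eq : (S.X : A) * S.y = S.z * S.X - S.δ • (S.z : A) + S.δ • ((S.z : A) * S.e) := by
  rw [← z_mul_X_inv, X_inv_eq]
  simp [mul_add, mul_sub]

lemma X_mul_y_pow_succ_mul (n : ℕ) (x : A) :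
    (S.X : A) * ((S.y ^ (n + 1) : Aˣ) : A) * x = S.z * (S.X * ((S.y ^ n : Aˣ) : A) * x)
      - S.δ • (S.z * (((S.y ^ n : Aˣ) : A) * x))
      + S.δ • (S.z * (S.e * ((S.y ^ n : Aˣ) : A) * x)) := by
  rw [pow_succ', Units.val_mul, ← mul_assoc, Xy_eq]
  simp only [sub_mul, add_mul, mul_assoc, smul_mul_assoc]

lemma X_y_pow_e_mem_G (n : ℕ) : (S.X : A) * ((S.y ^ n : Aˣ) : A) * S.e ∈ S.G n := by
  induction n with
  | zero =>
    rw [pow_zero, Units.val_one, mul_one, X_e]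
    exact Submodule.smul_mem _ _ (by simpa using y_e_mem_G (S := S) 0)
  | succ n ih =>
    rw [X_mul_y_pow_succ_mul]
    have h1 := y_e_mem_G (S := S) n
    have h2 := e_y_e_mem_G (S := S) n
    rw [zpow_natCast] at h1 h2
    exact add_mem (sub_mem (z_mul_mem_G ih) (Submodule.smul_mem _ _ (z_mul_mem_G h1)))
      (Submodule.smul_mem _ _ (z_mul_mem_G (G_mono n.zero_le h2)))

lemma X_y_pow_X_sub_mem_N (n : ℕ) :
    (S.X : A) * ((S.y ^ (n + 1) : Aˣ) : A) * S.X - ((S.z ^ (n + 1) : Aˣ) : A)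
      ∈ S.N n (n + 1) := by
  induction n with
  | zero => simp [S.z_eq]
  | succ n ih =>
    rw [X_mul_y_pow_succ_mul, pow_succ' S.z, Units.val_mul, add_sub_right_comm,
      sub_right_comm, ← mul_sub]
    refine add_mem (sub_mem (z_mul_mem_N ih) (Submodule.smul_mem _ _ ?_))
      (Submodule.smul_mem _ _ ?_)
    · refine N_mono (s := 0 + 1) (by omega) le_rfl (z_mul_mem_N ?_)
      have h := yXy_mem_N (S := S) (s := 0) (a := (n + 1 : ℕ)) (t := n + 1)
        (by push_cast; grind) 0
      rwa [zpow_natCast, zpow_zero, Units.val_one, mul_one] at h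
    · exact N_mono (s := 0 + 1) (by omega) le_rfl (z_mul_mem_N (E_le_N (e_y_pow_X_mem_E _)))

lemma X_y_pow_X_mem_N (n : ℕ) : (S.X : A) * ((S.y ^ n : Aˣ) : A) * S.X ∈ S.N n n := by
  cases n with
  | zero =>
    have h : (S.X : A) * S.X = 1 + S.δ • (S.X : A) - S.δ • ((S.lam : R) • S.e) := by
      nth_rewrite 1 [S.X_eq]
      rw [sub_mul, add_mul, smul_mul_assoc, smul_mul_assoc, one_mul, e_X, Units.inv_mul]
    rw [pow_zero, Units.val_one, mul_one, h]
    refine sub_mem (add_mem ?_ (Submodule.smul_mem _ _ ?_))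
      (Submodule.smul_mem _ _ (Submodule.smul_mem _ _ ?_))
    · simpa using z_pow_mem_N (S := S) (s := 0) (t := 0)
    · simpa using yXy_mem_N (S := S) (s := 0) (t := 0) (a := 0) (by simp) 0
    · exact E_le_N (by simpa using e_y_mem_E (S := S) 0)
  | succ n =>
    have h := add_mem (N_mono n.le_succ le_rfl (X_y_pow_X_sub_mem_N (S := S) n))
      (z_pow_mem_N (S := S) (s := n + 1) (t := n + 1))
    rwa [sub_add_cancel] at h

lemma e_y_pow_X_mem_N (n : ℕ) : S.e * ((S.y ^ n : Aˣ) : A) * S.X ∈ S.N n n :=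
  E_le_N (e_y_pow_X_mem_E n)

variable (S) in
/-- The span of the elements `z^a y^b`, `y^a X y^b` and `y^a e y^b w` with `|a| ≤ |p|`, where in the
first family `a` and `p` do not have opposite signs. -/
def T (p : ℤ) : Submodule R A := Submodule.span R
  ({x | ∃ a b : ℤ, |a| ≤ |p| ∧ 0 ≤ a * p ∧ x = ((S.z ^ a : Aˣ) : A) * ((S.y ^ b : Aˣ) : A)} ∪
   {x | ∃ a b : ℤ, |a| ≤ |p| ∧ x = ((S.y ^ a : Aˣ) : A) * S.X * ((S.y ^ b : Aˣ) : A)} ∪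
   {x | ∃ a b : ℤ, |a| ≤ |p| ∧ ∃ w ∈ S.W,
      x = ((S.y ^ a : Aˣ) : A) * S.e * ((S.y ^ b : Aˣ) : A) * w})

lemma zy_mem_T {p a : ℤ} (h : |a| ≤ |p|) (h' : 0 ≤ a * p) (b : ℤ) :
    ((S.z ^ a : Aˣ) : A) * ((S.y ^ b : Aˣ) : A) ∈ S.T p :=
  Submodule.subset_span (.inl (.inl ⟨a, b, h, h', rfl⟩))

lemma yXy_mem_T {p a : ℤ} (h : |a| ≤ |p|) (b : ℤ) :
    ((S.y ^ a : Aˣ) : A) * S.X * ((S.y ^ b : Aˣ) : A) ∈ S.T p :=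
  Submodule.subset_span (.inl (.inr ⟨a, b, h, rfl⟩))

lemma yey_mem_T {p a : ℤ} (h : |a| ≤ |p|) (b : ℤ) {w : A} (hw : w ∈ S.W) :
    ((S.y ^ a : Aˣ) : A) * S.e * ((S.y ^ b : Aˣ) : A) * w ∈ S.T p :=
  Submodule.subset_span (.inr ⟨a, b, h, w, hw, rfl⟩)

lemma N_le_T (n : ℕ) : S.N n n ≤ S.T n := by
  refine Submodule.span_le.2 ?_
  rintro _ ((⟨a, h, b, rfl⟩ | ⟨a, b, h, rfl⟩) | ⟨a, b, h, w, hw, rfl⟩)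
  · rw [← zpow_natCast]
    exact zy_mem_T (by rw [Nat.abs_cast, Nat.abs_cast]; exact_mod_cast h) (by positivity) b
  · exact yXy_mem_T (by rwa [Nat.abs_cast]) b
  · exact yey_mem_T (by rwa [Nat.abs_cast]) b hw

lemma flip_N_le_T (n : ℕ) : S.flip.N n n ≤ S.T (-n) := by
  refine Submodule.span_le.2 ?_
  rintro _ ((⟨a, h, b, rfl⟩ | ⟨a, b, h, rfl⟩) | ⟨a, b, h, w, hw, rfl⟩)
  · change ((S.z⁻¹ ^ a : Aˣ) : A) * ((S.y⁻¹ ^ b : Aˣ) : A) ∈ S.T (-n)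
    rw [← zpow_natCast, inv_zpow', inv_zpow']
    refine zy_mem_T ?_ ?_ _
    · rw [abs_neg, abs_neg, Nat.abs_cast, Nat.abs_cast]; exact_mod_cast h
    · rw [neg_mul_neg]; positivity
  · change ((S.y⁻¹ ^ a : Aˣ) : A) * ((S.X⁻¹ : Aˣ) : A) * ((S.y⁻¹ ^ b : Aˣ) : A) ∈ S.T (-n)
    have ha : |-a| ≤ |(-n : ℤ)| := by rwa [abs_neg, abs_neg, Nat.abs_cast]
    have key : ((S.y ^ (-a) : Aˣ) : A) * ((S.X⁻¹ : Aˣ) : A) * ((S.y ^ (-b) : Aˣ) : A)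
        = ((S.y ^ (-a) : Aˣ) : A) * S.X * ((S.y ^ (-b) : Aˣ) : A)
          - S.δ • (((S.z ^ (0 : ℤ) : Aˣ) : A) * ((S.y ^ (-a + -b) : Aˣ) : A))
          + S.δ • (((S.y ^ (-a) : Aˣ) : A) * S.e * ((S.y ^ (-b) : Aˣ) : A) * 1) := by
      rw [X_inv_eq, zpow_add, Units.val_mul, zpow_zero, Units.val_one, one_mul, mul_one]
      simp only [mul_add, mul_sub, add_mul, sub_mul, smul_mul_assoc, mul_smul_comm, mul_one]
    rw [inv_zpow', inv_zpow', key]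
    exact add_mem (sub_mem (yXy_mem_T ha _) (Submodule.smul_mem _ _ (zy_mem_T (by simp) (by simp) _)))
      (Submodule.smul_mem _ _ (yey_mem_T ha _ (one_mem _)))
  · change ((S.y⁻¹ ^ a : Aˣ) : A) * S.e * ((S.y⁻¹ ^ b : Aˣ) : A) * w ∈ S.T (-n)
    rw [inv_zpow', inv_zpow']
    exact yey_mem_T (by rwa [abs_neg, abs_neg, Nat.abs_cast]) _ hw

lemma flip_G_le (n : ℕ) : S.flip.G n ≤ S.G n := by
  refine Submodule.span_le.2 ?_
  rintro _ ⟨a, h, w, hw, rfl⟩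
  change ((S.y⁻¹ ^ a : Aˣ) : A) * S.e * w ∈ S.G n
  rw [inv_zpow']
  exact ye_mem_G (by rwa [abs_neg]) hw

lemma e_mul_z_zpow_mem_T (p : ℤ) : S.e * ((S.z ^ p : Aˣ) : A) ∈ S.T p := by
  rw [e_mul_z_zpow]
  simpa using yey_mem_T (S := S) (p := p) (a := 0) (by simp) (-p) (one_mem _)

lemma z_zpow_mem_T (p : ℤ) : ((S.z ^ p : Aˣ) : A) ∈ S.T p := by
  simpa using zy_mem_T (S := S) (p := p) le_rfl (mul_self_nonneg p) 0

lemma X_mul_z_zpow_mem_T (p : ℤ) : (S.X : A) * ((S.z ^ p : Aˣ) : A) ∈ S.T p := by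
  obtain ⟨n, rfl | rfl⟩ := p.eq_nat_or_neg
  · exact zpow_natCast S.z n ▸ N_le_T n (X_mul_z_pow_mem_N n)
  · have h := flip_N_le_T n (X_mul_z_pow_mem_N (S := S.flip) n)
    change ((S.X⁻¹ : Aˣ) : A) * ((S.z⁻¹ ^ n : Aˣ) : A) ∈ S.T (-n) at h
    rw [← zpow_natCast, inv_zpow'] at h
    rw [X_eq, sub_mul, add_mul, smul_mul_assoc, smul_mul_assoc, one_mul]
    exact sub_mem (add_mem h (Submodule.smul_mem _ _ (z_zpow_mem_T _)))
      (Submodule.smul_mem _ _ (e_mul_z_zpow_mem_T _))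

lemma E_le_T (p : ℤ) : S.E ≤ S.T p := by
  refine Submodule.span_le.2 ?_
  rintro _ ⟨b, w, hw, rfl⟩
  simpa using yey_mem_T (S := S) (p := p) (a := 0) (by simp) b hw

lemma e_y_zpow_X_mem_T (p : ℤ) : S.e * ((S.y ^ p : Aˣ) : A) * S.X ∈ S.T p := by
  obtain ⟨n, rfl | rfl⟩ := p.eq_nat_or_neg
  · exact zpow_natCast S.y n ▸ N_le_T n (e_y_pow_X_mem_N n)
  · have h := flip_N_le_T n (e_y_pow_X_mem_N (S := S.flip) n)
    change S.e * ((S.y⁻¹ ^ n : Aˣ) : A) * ((S.X⁻¹ : Aˣ) : A) ∈ S.T (-n) at h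
    rw [← zpow_natCast, inv_zpow'] at h
    rw [X_eq, mul_sub, mul_add, mul_smul_comm, mul_smul_comm, mul_one]
    exact sub_mem (add_mem h (Submodule.smul_mem _ _ (E_le_T _ (e_y_mem_E _))))
      (Submodule.smul_mem _ _ (E_le_T _ (e_y_e_mem_E _)))

lemma y_zpow_e_mem_T (p : ℤ) : ((S.y ^ p : Aˣ) : A) * S.e ∈ S.T p := by
  simpa using yey_mem_T (S := S) (p := p) le_rfl 0 (one_mem _)

lemma G_le_T (p : ℤ) : S.G p.natAbs ≤ S.T p := by
  refine Submodule.span_le.2 ?_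
  rintro _ ⟨a, ha, w, hw, rfl⟩
  simpa using yey_mem_T (S := S) (p := p) (by rwa [Int.abs_eq_natAbs p]) 0 hw

lemma X_y_zpow_e_mem_G (p : ℤ) : (S.X : A) * ((S.y ^ p : Aˣ) : A) * S.e ∈ S.G p.natAbs := by
  obtain ⟨n, rfl | rfl⟩ := p.eq_nat_or_neg
  · exact zpow_natCast S.y n ▸ X_y_pow_e_mem_G n
  · have h := flip_G_le n (X_y_pow_e_mem_G (S := S.flip) n)
    change ((S.X⁻¹ : Aˣ) : A) * ((S.y⁻¹ ^ n : Aˣ) : A) * S.e ∈ S.G n at h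
    rw [← zpow_natCast, inv_zpow'] at h
    have h0 := y_e_mem_G (S := S) (-n)
    rw [Int.natAbs_neg, Int.natAbs_natCast] at h0 ⊢
    rw [X_eq, sub_mul, add_mul, smul_mul_assoc, smul_mul_assoc, one_mul, sub_mul, add_mul,
      smul_mul_assoc, smul_mul_assoc]
    exact sub_mem (add_mem h (Submodule.smul_mem _ _ h0))
      (Submodule.smul_mem _ _ (G_mono n.zero_le (e_y_e_mem_G _)))

lemma X_y_zpow_X_mem_T (p : ℤ) : (S.X : A) * ((S.y ^ p : Aˣ) : A) * S.X ∈ S.T p := by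
  obtain ⟨n, rfl | rfl⟩ := p.eq_nat_or_neg
  · exact zpow_natCast S.y n ▸ N_le_T n (X_y_pow_X_mem_N n)
  · have h := flip_N_le_T n (X_y_pow_X_mem_N (S := S.flip) n)
    change ((S.X⁻¹ : Aˣ) : A) * ((S.y⁻¹ ^ n : Aˣ) : A) * ((S.X⁻¹ : Aˣ) : A) ∈ S.T (-n) at h
    rw [← zpow_natCast, inv_zpow'] at h
    have key (u : A) : (S.X : A) * u * S.X = ((S.X⁻¹ : Aˣ) : A) * u * ((S.X⁻¹ : Aˣ) : A)
        + S.δ • (u * S.X) - S.δ • (S.e * u * S.X) + S.δ • (S.X * u)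
        - S.δ • (S.X * u * S.e) - S.δ • S.δ • (u - u * S.e - S.e * u + S.e * u * S.e) := by
      rw [X_inv_eq]
      simp only [mul_add, mul_sub, add_mul, sub_mul, smul_mul_assoc, mul_smul_comm, mul_one,
        one_mul, smul_sub, smul_add]
      abel
    have hu := yXy_mem_T (S := S) (p := (-n : ℤ)) (a := 0) (by simp) (-n)
    rw [zpow_zero, Units.val_one, one_mul] at hu
    have hu' := yXy_mem_T (S := S) (p := (-n : ℤ)) (a := -n) le_rfl 0
    rw [zpow_zero, Units.val_one, mul_one] at hu'
    have hy := zy_mem_T (S := S) (p := (-n : ℤ)) (a := 0) (by simp) (by simp) (-n)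
    rw [zpow_zero, Units.val_one, one_mul] at hy
    rw [key]
    refine sub_mem (sub_mem (add_mem (sub_mem (add_mem h ?_) ?_) ?_) ?_) ?_ <;>
      refine Submodule.smul_mem _ _ ?_
    · exact hu'
    · exact e_y_zpow_X_mem_T _
    · exact hu
    · exact G_le_T _ (X_y_zpow_e_mem_G _)
    · exact Submodule.smul_mem _ _ (add_mem (sub_mem (sub_mem hy (y_zpow_e_mem_T _))
        (E_le_T _ (e_y_mem_E _))) (E_le_T _ (e_y_e_mem_E _)))

/-- The elements `x` with `f x f ∈ f W`. -/
def loopSubmodule (f : A) (W : Subalgebra R A) : Submodule R A :=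
  (W.toSubmodule.map (LinearMap.mulLeft R f)).comap
    (LinearMap.mulLeft R f ∘ₗ LinearMap.mulRight R f)

lemma mem_loopSubmodule {f : A} {W : Subalgebra R A} {x : A} :
    x ∈ loopSubmodule f W ↔ ∃ w ∈ W, f * x * f = f * w := by
  simp [loopSubmodule, mul_assoc, eq_comm]

lemma mul_mem_loopSubmodule {f : A} {W : Subalgebra R A} (hf : ∀ w ∈ W, Commute w f) {x w : A}
    (hw : w ∈ W) (hx : x ∈ loopSubmodule f W) : w * x ∈ loopSubmodule f W := by
  obtain ⟨v, hv, h⟩ := mem_loopSubmodule.1 hx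
  refine mem_loopSubmodule.2 ⟨w * v, mul_mem hw hv, ?_⟩
  rw [← mul_assoc, ← (hf w hw).eq, mul_assoc, mul_assoc, ← mul_assoc f, h, ← mul_assoc,
    (hf w hw).eq, mul_assoc]

lemma mem_loopSubmodule_mul {f : A} {W : Subalgebra R A} (hf : ∀ w ∈ W, Commute w f) {x w : A}
    (hw : w ∈ W) (hx : x ∈ loopSubmodule f W) : x * w ∈ loopSubmodule f W := by
  obtain ⟨v, hv, h⟩ := mem_loopSubmodule.1 hx
  refine mem_loopSubmodule.2 ⟨v * w, mul_mem hv hw, ?_⟩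
  rw [mul_assoc, mul_assoc, (hf w hw).eq, ← mul_assoc, ← mul_assoc, h, mul_assoc]

/-- Loops around the strand of `z` in terms of loops around the strand of `y`, where `f` is the
cup-cap next to `e`. -/
structure Loopable (S : StrandPair R A) (f : A) (W : Subalgebra R A) : Prop where
  le : S.W ≤ W
  y_mem : ∀ c : ℤ, ((S.y ^ c : Aˣ) : A) ∈ W
  comm : ∀ w ∈ W, Commute w f
  one_mem : 1 ∈ loopSubmodule f W
  X_mem : (S.X : A) ∈ loopSubmodule f W
  X_inv_mem : ((S.X⁻¹ : Aˣ) : A) ∈ loopSubmodule f W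
  f_e_f : f * S.e * f = f
  conj : ∀ c : ℤ, f * (S.X * ((S.y ^ c : Aˣ) : A) * ((S.X⁻¹ : Aˣ) : A)) * f
    = f * (S.e * ((S.y ^ c : Aˣ) : A) * S.e) * f
  conj_inv : ∀ c : ℤ, f * (((S.X⁻¹ : Aˣ) : A) * ((S.y ^ c : Aˣ) : A) * S.X) * f
    = f * (S.e * ((S.y ^ c : Aˣ) : A) * S.e) * f

lemma Loopable.flip {f : A} {W : Subalgebra R A} (h : S.Loopable f W) : S.flip.Loopable f W where
  le := h.le
  y_mem c := by
    change ((S.y⁻¹ ^ c : Aˣ) : A) ∈ W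
    rw [inv_zpow']
    exact h.y_mem _
  comm := h.comm
  one_mem := h.one_mem
  X_mem := h.X_inv_mem
  X_inv_mem := by
    change ((S.X⁻¹⁻¹ : Aˣ) : A) ∈ _
    rw [inv_inv]
    exact h.X_mem
  f_e_f := h.f_e_f
  conj c := by
    change f * (((S.X⁻¹ : Aˣ) : A) * ((S.y⁻¹ ^ c : Aˣ) : A) * ((S.X⁻¹⁻¹ : Aˣ) : A)) * f
      = f * (S.e * ((S.y⁻¹ ^ c : Aˣ) : A) * S.e) * f
    rw [inv_inv, inv_zpow']
    exact h.conj_inv _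
  conj_inv c := by
    change f * (((S.X⁻¹⁻¹ : Aˣ) : A) * ((S.y⁻¹ ^ c : Aˣ) : A) * ((S.X⁻¹ : Aˣ) : A)) * f
      = f * (S.e * ((S.y⁻¹ ^ c : Aˣ) : A) * S.e) * f
    rw [inv_inv, inv_zpow']
    exact h.conj _

lemma Loopable.e_mem {f : A} {W : Subalgebra R A} (h : S.Loopable f W) :
    S.e ∈ loopSubmodule f W :=
  mem_loopSubmodule.2 ⟨1, OneMemClass.one_mem W, by rw [h.f_e_f, mul_one]⟩

lemma Loopable.N_le {f : A} {W : Subalgebra R A} (h : S.Loopable f W) {s : ℕ} (t : ℕ)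
    (hs : ∀ a ≤ s, ((S.z ^ a : Aˣ) : A) ∈ loopSubmodule f W) : S.N s t ≤ loopSubmodule f W := by
  refine Submodule.span_le.2 ?_
  rintro _ ((⟨a, ha, b, rfl⟩ | ⟨a, b, -, rfl⟩) | ⟨a, b, -, w, hw, rfl⟩)
  · exact mem_loopSubmodule_mul h.comm (h.y_mem b) (hs a ha)
  · exact mem_loopSubmodule_mul h.comm (h.y_mem b) (mul_mem_loopSubmodule h.comm (h.y_mem a) h.X_mem)
  · exact mem_loopSubmodule_mul h.comm (h.le hw) (mem_loopSubmodule_mul h.comm (h.y_mem b)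
      (mul_mem_loopSubmodule h.comm (h.y_mem a) h.e_mem))

lemma Loopable.z_pow_mem {f : A} {W : Subalgebra R A} (h : S.Loopable f W) (n : ℕ) :
    ((S.z ^ n : Aˣ) : A) ∈ loopSubmodule f W := by
  induction n using Nat.strong_induction_on with
  | _ n ih =>
  cases n with
  | zero => simpa using h.one_mem
  | succ n =>
    have hN (t : ℕ) : S.N n t ≤ loopSubmodule f W := h.N_le t fun a ha => ih a (by omega)
    have h1 := hN _ (X_y_pow_X_sub_mem_N n)
    set u : A := ((S.y ^ (n + 1) : Aˣ) : A) with hu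
    have hu' : u = ((S.y ^ ((n + 1 : ℕ) : ℤ) : Aˣ) : A) := by rw [zpow_natCast]
    have h2 : (S.X : A) * u * ((S.X⁻¹ : Aˣ) : A) ∈ loopSubmodule f W := by
      obtain ⟨w, hw, hl⟩ := S.loop (n + 1 : ℕ)
      refine mem_loopSubmodule.2 ⟨w, h.le hw, ?_⟩
      rw [hu', h.conj, hl, mul_assoc, mul_assoc, (h.comm w (h.le hw)).eq, ← mul_assoc, ← mul_assoc,
        h.f_e_f]
    have h3 : (S.X : A) * u ∈ loopSubmodule f W :=
      hu' ▸ mem_loopSubmodule_mul h.comm (h.y_mem _) h.X_mem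
    have h4 : (S.X : A) * u * S.e ∈ loopSubmodule f W :=
      hN (n + 1) (G_le_N (X_y_pow_e_mem_G _))
    have h5 : (S.X : A) * u * S.X ∈ loopSubmodule f W := by
      have := sub_mem (add_mem h2 (Submodule.smul_mem _ S.δ h3)) (Submodule.smul_mem _ S.δ h4)
      convert this using 1
      conv_lhs => rw [S.X_eq, mul_sub, mul_add, ← S.X_eq]
      rw [mul_smul_comm, mul_smul_comm, mul_one]
    simpa using sub_mem h5 h1

lemma Loopable.exists_loop {f : A} {W : Subalgebra R A} (h : S.Loopable f W) (c : ℤ) :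
    ∃ w ∈ W, f * ((S.z ^ c : Aˣ) : A) * f = f * w := by
  rw [← mem_loopSubmodule]
  obtain ⟨n, rfl | rfl⟩ := c.eq_nat_or_neg
  · rw [zpow_natCast]
    exact h.z_pow_mem n
  · have := h.flip.z_pow_mem n
    change ((S.z⁻¹ ^ n : Aˣ) : A) ∈ _ at this
    rwa [← zpow_natCast, inv_zpow'] at this

end StrandPair

/-- A representation of the affine BMW algebra in `A` with crossings `X 1, …, X r` and cup-caps
`e 1, …, e r`. -/
structure AffineBMW (R A : Type*) [CommRing R] [Ring A] [Algebra R A] where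
  r : ℕ
  δ : R
  lam : Rˣ
  X : ℕ → Aˣ
  e : ℕ → A
  Y : Aˣ
  skein : ∀ {i}, 1 ≤ i → i ≤ r → (X i : A) - ((X i)⁻¹ : Aˣ) = δ • (1 - e i)
  XX_far : ∀ {i j}, 1 ≤ i → i + 2 ≤ j → j ≤ r → Commute (X i : A) (X j)
  XE_far : ∀ {i j}, 1 ≤ i → i ≤ r → 1 ≤ j → j ≤ r → i + 2 ≤ j ∨ j + 2 ≤ i → Commute (X i : A) (e j)
  EE_far : ∀ {i j}, 1 ≤ i → i + 2 ≤ j → j ≤ r → Commute (e i) (e j)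
  braid : ∀ {i}, 1 ≤ i → i + 1 ≤ r → (X i : A) * X (i + 1) * X i = X (i + 1) * X i * X (i + 1)
  X_e : ∀ {i}, 1 ≤ i → i ≤ r → (X i : A) * e i = (lam : R) • e i
  e_X : ∀ {i}, 1 ≤ i → i ≤ r → e i * (X i : A) = (lam : R) • e i
  XXE : ∀ {i j}, 1 ≤ i → i ≤ r → 1 ≤ j → j ≤ r → j = i + 1 ∨ i = j + 1 →
    (X i : A) * X j * e i = e j * e i
  EXX : ∀ {i j}, 1 ≤ i → i ≤ r → 1 ≤ j → j ≤ r → j = i + 1 ∨ i = j + 1 →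
    e j * e i = e j * X i * X j
  EEE : ∀ {i j}, 1 ≤ i → i ≤ r → 1 ≤ j → j ≤ r → j = i + 1 ∨ i = j + 1 → e i * e j * e i = e i
  e_sq : ∀ {i}, 1 ≤ i → i ≤ r → ∃ a : R, e i * e i = a • e i
  braidB : 1 ≤ r → (X 1 : A) * Y * X 1 * Y = Y * X 1 * Y * X 1
  YX : ∀ {i}, 2 ≤ i → i ≤ r → Commute (Y : A) (X i)
  YE : ∀ {i}, 2 ≤ i → i ≤ r → Commute (Y : A) (e i)
  YXYE : 1 ≤ r → (Y : A) * X 1 * Y * e 1 = ((lam⁻¹ : Rˣ) : R) • e 1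
  EYXY : 1 ≤ r → e 1 * ((Y : A) * X 1 * Y) = ((lam⁻¹ : Rˣ) : R) • e 1
  EYE : 1 ≤ r → ∀ c : ℤ, ∃ a : R, e 1 * ((Y ^ c : Aˣ) : A) * e 1 = a • e 1

namespace AffineBMW

variable {R A : Type*} [CommRing R] [Ring A] [Algebra R A] (B : AffineBMW R A)

/-- The Jucys-Murphy elements. -/
def y : ℕ → Aˣ
  | 0 => B.Y
  | 1 => B.Y
  | i + 2 => B.X (i + 1) * y (i + 1) * B.X (i + 1)

variable {B}

lemma y_succ {i : ℕ} (h : 1 ≤ i) : B.y (i + 1) = B.X i * B.y i * B.X i := by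
  obtain ⟨i, rfl⟩ := Nat.exists_eq_succ_of_ne_zero (by omega : i ≠ 0)
  rfl

lemma y_succ_val {i : ℕ} (h : 1 ≤ i) : (B.y (i + 1) : A) = B.X i * B.y i * B.X i := by
  rw [y_succ h, Units.val_mul, Units.val_mul]

lemma commute_X_X {i j : ℕ} (hi : 1 ≤ i) (hi' : i ≤ B.r) (hj : 1 ≤ j) (hj' : j ≤ B.r)
    (h : i + 2 ≤ j ∨ j + 2 ≤ i) : Commute (B.X i : A) (B.X j) := by
  rcases h with h | h
  · exact B.XX_far hi h hj'
  · exact (B.XX_far hj h hi').symm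

lemma commute_e_e {i j : ℕ} (hi : 1 ≤ i) (hi' : i ≤ B.r) (hj : 1 ≤ j) (hj' : j ≤ B.r)
    (h : i + 2 ≤ j ∨ j + 2 ≤ i) : Commute (B.e i) (B.e j) := by
  rcases h with h | h
  · exact B.EE_far hi h hj'
  · exact (B.EE_far hj h hi').symm

lemma e_succ_mul_X_X {i : ℕ} (h : 1 ≤ i) (h' : i + 1 ≤ B.r) :
    B.e (i + 1) * (B.X i * B.X (i + 1)) = B.X i * B.X (i + 1) * B.e i := by
  rw [← mul_assoc, ← B.EXX (by omega) (by omega) (by omega) (by omega) (.inl rfl),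
    B.XXE (by omega) (by omega) (by omega) (by omega) (.inl rfl)]

lemma e_mul_X_succ_X {i : ℕ} (h : 1 ≤ i) (h' : i + 1 ≤ B.r) :
    B.e i * (B.X (i + 1) * B.X i) = B.X (i + 1) * B.X i * B.e (i + 1) := by
  rw [← mul_assoc, ← B.EXX (by omega) (by omega) (by omega) (by omega) (.inr rfl),
    B.XXE (by omega) (by omega) (by omega) (by omega) (.inr rfl)]

/-- An element intertwined by the crossings with an element commuting with `y m` commutes with
`y (m + 2)`. -/
lemma commute_y_of_intertwine {m : ℕ} (hm : 1 ≤ m) {a b : A}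
    (h₁ : a * (B.X (m + 1) * B.X m) = B.X (m + 1) * B.X m * b)
    (h₂ : b * (B.X m * B.X (m + 1)) = B.X m * B.X (m + 1) * a) (hb : Commute b (B.y m : A)) :
    Commute a (B.y (m + 2) : A) := by
  have hy : (B.y (m + 2) : A)
      = (B.X (m + 1) * B.X m) * B.y m * (B.X m * B.X (m + 1)) := by
    rw [y_succ_val (by omega), y_succ_val hm]
    simp only [mul_assoc]
  calc a * (B.y (m + 2) : A)
      = a * (B.X (m + 1) * B.X m) * B.y m * (B.X m * B.X (m + 1)) := by
        rw [hy]; simp only [mul_assoc]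
    _ = B.X (m + 1) * B.X m * (b * B.y m) * (B.X m * B.X (m + 1)) := by
        rw [h₁]; simp only [mul_assoc]
    _ = B.X (m + 1) * B.X m * B.y m * (b * (B.X m * B.X (m + 1))) := by
        rw [hb.eq]; simp only [mul_assoc]
    _ = B.y (m + 2) * a := by rw [h₂, hy]; simp only [mul_assoc]

lemma commute_X_y {m i : ℕ} (hm : 1 ≤ m) (hm' : m ≤ B.r) (hi : 1 ≤ i) (hi' : i ≤ B.r + 1)
    (h : m ≠ i) (h' : m + 1 ≠ i) : Commute (B.X m : A) (B.y i) := by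
  induction i using Nat.strong_induction_on generalizing m with
  | _ i ih =>
  obtain rfl | ⟨i, rfl, hi₀⟩ : i = 1 ∨ ∃ i', i = i' + 1 ∧ 1 ≤ i' :=
    (by omega : i = 1 ∨ 2 ≤ i).imp id fun h => ⟨i - 1, by omega, by omega⟩
  · exact (B.YX (by omega) hm').symm
  · by_cases hmi : m + 1 = i
    · subst hmi
      refine commute_y_of_intertwine hm (b := B.X (m + 1)) ?_ ?_ ?_
      · rw [← mul_assoc, B.braid hm (by omega)]
      · rw [← mul_assoc, ← B.braid hm (by omega)]
      · exact ih m (by omega) (by omega) (by omega) (by omega) (by omega) (by omega) (by omega)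
    · have hX : Commute (B.X m : A) (B.X i) :=
        commute_X_X hm hm' hi₀ (by omega) (by omega)
      rw [y_succ_val hi₀]
      exact (hX.mul_right
        (ih i (by omega) hm hm' hi₀ (by omega) (by omega) (by omega))).mul_right hX

lemma commute_e_y {m i : ℕ} (hm : 1 ≤ m) (hm' : m ≤ B.r) (hi : 1 ≤ i) (hi' : i ≤ B.r + 1)
    (h : m ≠ i) (h' : m + 1 ≠ i) : Commute (B.e m) (B.y i : A) := by
  induction i using Nat.strong_induction_on generalizing m with
  | _ i ih =>
  obtain rfl | ⟨i, rfl, hi₀⟩ : i = 1 ∨ ∃ i', i = i' + 1 ∧ 1 ≤ i' :=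
    (by omega : i = 1 ∨ 2 ≤ i).imp id fun h => ⟨i - 1, by omega, by omega⟩
  · exact (B.YE (by omega) hm').symm
  · by_cases hmi : m + 1 = i
    · subst hmi
      refine commute_y_of_intertwine hm (b := B.e (m + 1)) ?_ ?_ ?_
      · exact e_mul_X_succ_X hm (by omega)
      · exact e_succ_mul_X_X hm (by omega)
      · exact ih m (by omega) (by omega) (by omega) (by omega) (by omega) (by omega) (by omega)
    · have hX : Commute (B.e m) (B.X i : A) :=
        (B.XE_far hi₀ (by omega) hm hm' (by omega)).symm
      rw [y_succ_val hi₀]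
      exact (hX.mul_right
        (ih i (by omega) hm hm' hi₀ (by omega) (by omega) (by omega))).mul_right hX

lemma commute_y_y {a b : ℕ} (ha : 1 ≤ a) (hab : a < b) (hb : b ≤ B.r + 1) :
    Commute (B.y a : A) (B.y b) := by
  induction a, ha using Nat.le_induction with
  | base =>
    induction b, hab using Nat.le_induction with
    | base =>
      rw [y_succ_val le_rfl, Commute, SemiconjBy, ← mul_assoc, ← mul_assoc]
      exact (B.braidB (by omega)).symm
    | succ b hb' ih =>
      have hX : Commute (B.y 1 : A) (B.X b) := B.YX (by omega) (by omega)
      rw [y_succ_val (i := b) (by omega)]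
      exact (hX.mul_right (ih (by omega))).mul_right hX
  | succ a ha ih =>
    have hX : Commute (B.X a : A) (B.y b) :=
      commute_X_y (by omega) (by omega) (by omega) hb (by omega) (by omega)
    rw [y_succ_val ha]
    exact (hX.mul_left (ih (by omega))).mul_left hX

lemma e_mul_X_inv_X_inv {i j : ℕ} (hi : 1 ≤ i) (hi' : i ≤ B.r) (hj : 1 ≤ j) (hj' : j ≤ B.r)
    (h : j = i + 1 ∨ i = j + 1) :
    B.e i * B.e j * (((B.X i)⁻¹ : Aˣ) : A) = B.e i * B.X j := by
  rw [B.EXX hj hj' hi hi' (by tauto), Units.mul_inv_cancel_right]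

lemma X_inv_mul_e_e {i j : ℕ} (hi : 1 ≤ i) (hi' : i ≤ B.r) (hj : 1 ≤ j) (hj' : j ≤ B.r)
    (h : j = i + 1 ∨ i = j + 1) :
    (((B.X i)⁻¹ : Aˣ) : A) * (B.e j * B.e i) = B.X j * B.e i := by
  rw [← B.XXE hi hi' hj hj' h, mul_assoc, Units.inv_mul_cancel_left]

lemma X_inv_mul_e {i j : ℕ} (hi : 1 ≤ i) (hi' : i ≤ B.r) (hj : 1 ≤ j) (hj' : j ≤ B.r)
    (h : j = i + 1 ∨ i = j + 1) :
    (((B.X i)⁻¹ : Aˣ) : A) * B.e j = B.X j * B.e i * B.e j := by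
  rw [← X_inv_mul_e_e hi hi' hj hj' h, mul_assoc, B.EEE hj hj' hi hi' (by tauto)]

lemma X_mul_e {i j : ℕ} (hi : 1 ≤ i) (hi' : i ≤ B.r) (hj : 1 ≤ j) (hj' : j ≤ B.r)
    (h : j = i + 1 ∨ i = j + 1) :
    (B.X i : A) * B.e j = (((B.X j)⁻¹ : Aˣ) : A) * B.e i * B.e j := by
  rw [mul_assoc, ← B.XXE hj hj' hi hi' (by tauto), mul_assoc, Units.inv_mul_cancel_left]

lemma e_mul_X_inv {i j : ℕ} (hi : 1 ≤ i) (hi' : i ≤ B.r) (hj : 1 ≤ j) (hj' : j ≤ B.r)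
    (h : j = i + 1 ∨ i = j + 1) :
    B.e j * (((B.X i)⁻¹ : Aˣ) : A) = B.e j * B.e i * B.X j := by
  have := e_mul_X_inv_X_inv hi hi' hj hj' h
  rw [mul_assoc, ← this, ← mul_assoc, ← mul_assoc, B.EEE hj hj' hi hi' (by tauto)]

lemma e_mul_X {i j : ℕ} (hi : 1 ≤ i) (hi' : i ≤ B.r) (hj : 1 ≤ j) (hj' : j ≤ B.r)
    (h : j = i + 1 ∨ i = j + 1) :
    B.e j * (B.X i : A) = B.e j * B.e i * (((B.X j)⁻¹ : Aˣ) : A) := by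
  rw [e_mul_X_inv_X_inv hj hj' hi hi' (by tauto)]

lemma y_mul_X_inv {i : ℕ} (h : 1 ≤ i) :
    (B.y (i + 1) : A) * (((B.X i)⁻¹ : Aˣ) : A) = B.X i * B.y i := by
  rw [y_succ_val h, Units.mul_inv_cancel_right]

lemma X_inv_mul_y {i : ℕ} (h : 1 ≤ i) :
    (((B.X i)⁻¹ : Aˣ) : A) * (B.y (i + 1) : A) = B.y i * B.X i := by
  rw [y_succ_val h, mul_assoc, Units.inv_mul_cancel_left]

lemma yy_mul_e {i : ℕ} (hi : 1 ≤ i) (hi' : i ≤ B.r) :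
    (B.y i : A) * B.y (i + 1) * B.e i = B.e i := by
  induction i, hi using Nat.le_induction with
  | base =>
    rw [y_succ_val le_rfl, mul_assoc, mul_assoc _ (B.X 1 : A), B.X_e le_rfl hi', mul_smul_comm,
      mul_smul_comm, ← mul_assoc, ← mul_assoc]
    change (B.lam : R) • ((B.Y : A) * B.X 1 * B.Y * B.e 1) = B.e 1
    rw [B.YXYE hi', smul_smul, Units.mul_inv, one_smul]
  | succ i hi ih =>
    have hX : Commute (((B.X i)⁻¹ : Aˣ) : A) (B.y (i + 2) : A) :=
      (commute_X_y hi (by omega) (by omega) (by omega) (by omega) (by omega)).units_inv_left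
    have hX' : Commute (B.X (i + 1) : A) (B.y i : A) :=
      commute_X_y (by omega) (by omega) (by omega) (by omega) (by omega) (by omega)
    have he : B.e (i + 1) = (((B.X i)⁻¹ : Aˣ) : A) * (((B.X (i + 1))⁻¹ : Aˣ) : A)
        * (B.e i * B.e (i + 1)) := by
      rw [mul_assoc, X_inv_mul_e_e (by omega) hi' hi (by omega) (.inr rfl),
        Units.inv_mul_cancel_left]
    have he' : B.X i * (B.X (i + 1) : A) * (B.e i * B.e (i + 1)) = B.e (i + 1) := by
      rw [← mul_assoc, B.XXE hi (by omega) (by omega) hi' (.inl rfl),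
        B.EEE (by omega) hi' hi (by omega) (.inr rfl)]
    calc (B.y (i + 1) : A) * B.y (i + 2) * B.e (i + 1)
        = B.y (i + 1) * (B.y (i + 2) * (((B.X i)⁻¹ : Aˣ) : A)) * (((B.X (i + 1))⁻¹ : Aˣ) : A)
            * (B.e i * B.e (i + 1)) := by
          conv_lhs => rw [he]
          simp only [mul_assoc]
      _ = (B.y (i + 1) * (((B.X i)⁻¹ : Aˣ) : A)) * (B.y (i + 2) * (((B.X (i + 1))⁻¹ : Aˣ) : A))
            * (B.e i * B.e (i + 1)) := by
          rw [← hX.eq]; simp only [mul_assoc]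
      _ = B.X i * (B.y i * B.X (i + 1)) * (B.y (i + 1) * B.e i) * B.e (i + 1) := by
          rw [y_mul_X_inv hi, y_mul_X_inv (by omega)]; simp only [mul_assoc]
      _ = B.X i * B.X (i + 1) * (B.y i * B.y (i + 1) * B.e i) * B.e (i + 1) := by
          rw [← hX'.eq]; simp only [mul_assoc]
      _ = B.e (i + 1) := by rw [ih (by omega), mul_assoc _ (B.e i), he']

lemma e_mul_yy {i : ℕ} (hi : 1 ≤ i) (hi' : i ≤ B.r) :
    B.e i * ((B.y i : A) * B.y (i + 1)) = B.e i := by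
  induction i, hi using Nat.le_induction with
  | base =>
    have h : (B.y 1 : A) * B.y 2 = B.Y * B.X 1 * B.Y * B.X 1 := by
      rw [y_succ_val le_rfl, ← mul_assoc, ← mul_assoc]; rfl
    rw [h, ← mul_assoc, B.EYXY hi', smul_mul_assoc, B.e_X le_rfl hi', smul_smul, Units.inv_mul,
      one_smul]
  | succ i hi ih =>
    have hy := (commute_y_y (B := B) (a := i + 1) (b := i + 2) (by omega) (by omega) (by omega)).eq
    have hy' := (commute_y_y (B := B) (a := i) (b := i + 1) (by omega) (by omega) (by omega)).eq
    have hX : Commute (((B.X i)⁻¹ : Aˣ) : A) (B.y (i + 2) : A) :=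
      (commute_X_y hi (by omega) (by omega) (by omega) (by omega) (by omega)).units_inv_left
    have hX' : Commute (B.X (i + 1) : A) (B.y i : A) :=
      commute_X_y (by omega) (by omega) (by omega) (by omega) (by omega) (by omega)
    have he : B.e (i + 1) = B.e (i + 1) * B.e i * (((B.X (i + 1))⁻¹ : Aˣ) : A)
        * (((B.X i)⁻¹ : Aˣ) : A) := by
      rw [e_mul_X_inv_X_inv (by omega) hi' hi (by omega) (.inr rfl),
        Units.mul_inv_cancel_right]
    have he' : B.e (i + 1) * B.e i * (B.X (i + 1) * (B.X i : A)) = B.e (i + 1) := by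
      rw [mul_assoc, ← mul_assoc (B.e i), ← B.EXX (by omega) hi' hi (by omega) (.inr rfl),
        ← mul_assoc, B.EEE (by omega) hi' hi (by omega) (.inr rfl)]
    calc B.e (i + 1) * ((B.y (i + 1) : A) * B.y (i + 2))
        = B.e (i + 1) * B.e i * (((B.X (i + 1))⁻¹ : Aˣ) : A)
            * ((((B.X i)⁻¹ : Aˣ) : A) * B.y (i + 2)) * B.y (i + 1) := by
          conv_lhs => rw [he, hy]
          simp only [mul_assoc]
      _ = B.e (i + 1) * B.e i * ((((B.X (i + 1))⁻¹ : Aˣ) : A) * B.y (i + 2))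
            * ((((B.X i)⁻¹ : Aˣ) : A) * B.y (i + 1)) := by
          rw [hX.eq]; simp only [mul_assoc]
      _ = B.e (i + 1) * (B.e i * B.y (i + 1)) * (B.X (i + 1) * B.y i) * B.X i := by
          rw [X_inv_mul_y hi, X_inv_mul_y (by omega)]; simp only [mul_assoc]
      _ = B.e (i + 1) * (B.e i * (B.y i * B.y (i + 1))) * (B.X (i + 1) * B.X i) := by
          rw [hX'.eq, hy']; simp only [mul_assoc]
      _ = B.e (i + 1) := by rw [ih (by omega), he']

variable (B) in
/-- The subalgebra generated by the generators supported on the first `l` strands. -/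
def sub (l : ℕ) : Subalgebra R A :=
  Algebra.adjoin R ({(B.Y : A), ((B.Y⁻¹ : Aˣ) : A)} ∪
    {x | ∃ i, 1 ≤ i ∧ i + 1 ≤ l ∧
      (x = (B.X i : A) ∨ x = (((B.X i)⁻¹ : Aˣ) : A) ∨ x = B.e i)})

lemma Y_mem (l : ℕ) : (B.Y : A) ∈ B.sub l := Algebra.subset_adjoin (by simp)

lemma Y_inv_mem (l : ℕ) : ((B.Y⁻¹ : Aˣ) : A) ∈ B.sub l := Algebra.subset_adjoin (by simp)

lemma X_mem {i l : ℕ} (h : 1 ≤ i) (h' : i + 1 ≤ l) : (B.X i : A) ∈ B.sub l :=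
  Algebra.subset_adjoin (.inr ⟨i, h, h', .inl rfl⟩)

lemma X_inv_mem {i l : ℕ} (h : 1 ≤ i) (h' : i + 1 ≤ l) : (((B.X i)⁻¹ : Aˣ) : A) ∈ B.sub l :=
  Algebra.subset_adjoin (.inr ⟨i, h, h', .inr (.inl rfl)⟩)

lemma e_mem {i l : ℕ} (h : 1 ≤ i) (h' : i + 1 ≤ l) : B.e i ∈ B.sub l :=
  Algebra.subset_adjoin (.inr ⟨i, h, h', .inr (.inr rfl)⟩)

lemma sub_mono {l l' : ℕ} (h : l ≤ l') : B.sub l ≤ B.sub l' := by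
  refine Algebra.adjoin_mono (Set.union_subset_union_right _ ?_)
  rintro x ⟨i, hi, hi', hx⟩
  exact ⟨i, hi, by omega, hx⟩

lemma y_mem_and_inv_mem {i l : ℕ} (hi : 1 ≤ i) (h : i ≤ l) :
    (B.y i : A) ∈ B.sub l ∧ (((B.y i)⁻¹ : Aˣ) : A) ∈ B.sub l := by
  induction i, hi using Nat.le_induction with
  | base => exact ⟨Y_mem l, Y_inv_mem l⟩
  | succ i hi ih =>
    obtain ⟨h1, h2⟩ := ih (by omega)
    rw [y_succ hi, mul_inv_rev, mul_inv_rev]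
    simp only [Units.val_mul]
    exact ⟨mul_mem (mul_mem (X_mem hi h) h1) (X_mem hi h),
      mul_mem (X_inv_mem hi h) (mul_mem h2 (X_inv_mem hi h))⟩

lemma y_zpow_mem {i l : ℕ} (hi : 1 ≤ i) (h : i ≤ l) (p : ℤ) :
    ((B.y i ^ p : Aˣ) : A) ∈ B.sub l := by
  obtain ⟨h1, h2⟩ := y_mem_and_inv_mem (B := B) hi h
  obtain ⟨n, rfl | rfl⟩ := p.eq_nat_or_neg
  · rw [zpow_natCast, Units.val_pow_eq_pow_val]
    exact pow_mem h1 n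
  · rw [zpow_neg, ← inv_zpow, zpow_natCast, Units.val_pow_eq_pow_val]
    exact pow_mem h2 n

variable (B) in
/-- The elements supported on the first `i - 1` strands commuting with everything supported on the
strands from `i` on. -/
def coeff (i : ℕ) : Subalgebra R A :=
  B.sub (i - 1) ⊓ Subalgebra.centralizer R
    {x | ∃ j, i ≤ j ∧ ((j ≤ B.r ∧ (x = (B.X j : A) ∨ x = B.e j)) ∨
      (j ≤ B.r + 1 ∧ x = (B.y j : A)))}

lemma coeff_le_sub (i : ℕ) : B.coeff i ≤ B.sub (i - 1) := inf_le_left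

lemma coeff_X {i j : ℕ} (h : i ≤ j) (hj : j ≤ B.r) {w : A} (hw : w ∈ B.coeff i) :
    Commute w (B.X j : A) :=
  ((Subalgebra.mem_centralizer_iff R).1 hw.2 _ ⟨j, h, .inl ⟨hj, .inl rfl⟩⟩).symm

lemma coeff_e {i j : ℕ} (h : i ≤ j) (hj : j ≤ B.r) {w : A} (hw : w ∈ B.coeff i) :
    Commute w (B.e j) :=
  ((Subalgebra.mem_centralizer_iff R).1 hw.2 _ ⟨j, h, .inl ⟨hj, .inr rfl⟩⟩).symm

lemma coeff_y {i j : ℕ} (h : i ≤ j) (hj : j ≤ B.r + 1) {w : A} (hw : w ∈ B.coeff i) :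
    Commute w (B.y j : A) :=
  ((Subalgebra.mem_centralizer_iff R).1 hw.2 _ ⟨j, h, .inr ⟨hj, rfl⟩⟩).symm

lemma coeff_mono {i i' : ℕ} (h : i ≤ i') : B.coeff i ≤ B.coeff i' := by
  refine inf_le_inf (sub_mono (by omega)) (Subalgebra.centralizer_le R _ _ ?_)
  rintro x ⟨j, hj, hx⟩
  exact ⟨j, h.trans hj, hx⟩

lemma y_zpow_mem_coeff {i : ℕ} (hi : 1 ≤ i) (c : ℤ) :
    ((B.y i ^ c : Aˣ) : A) ∈ B.coeff (i + 1) := by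
  refine ⟨y_zpow_mem hi (by omega) c, (Subalgebra.mem_centralizer_iff R).2 ?_⟩
  rintro x ⟨j, hj, ⟨hj', rfl | rfl⟩ | ⟨hj', rfl⟩⟩
  · exact (commute_X_y (by omega) (by omega) hi (by omega) (by omega)
      (by omega)).units_zpow_right c
  · exact (commute_e_y (by omega) (by omega) hi (by omega) (by omega)
      (by omega)).units_zpow_right c
  · exact (commute_y_y hi (by omega) hj').symm.units_zpow_right c

variable (B) in
/-- The strands `i` and `i + 1`. -/
def pair {i : ℕ} (hi : 1 ≤ i) (hi' : i ≤ B.r)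
    (loop : ∀ c : ℤ, ∃ w ∈ B.coeff i, B.e i * ((B.y i ^ c : Aˣ) : A) * B.e i = B.e i * w) :
    StrandPair R A where
  X := B.X i
  y := B.y i
  z := B.y (i + 1)
  e := B.e i
  δ := B.δ
  lam := B.lam
  W := B.coeff i
  skein := B.skein hi hi'
  X_e := B.X_e hi hi'
  e_X := B.e_X hi hi'
  z_eq := y_succ hi
  comm := Units.ext (commute_y_y hi i.lt_succ_self (by omega))
  yz_e := yy_mul_e hi hi'
  e_yz := e_mul_yy hi hi'
  W_e _ hw := coeff_e le_rfl hi' hw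
  W_y _ hw := coeff_y le_rfl (by omega) hw
  W_z _ hw := coeff_y (by omega) (by omega) hw
  loop := loop

lemma pair_loopable {i : ℕ} (hi : 1 ≤ i) (hi' : i + 1 ≤ B.r)
    (loop : ∀ c : ℤ, ∃ w ∈ B.coeff i, B.e i * ((B.y i ^ c : Aˣ) : A) * B.e i = B.e i * w) :
    (B.pair hi (by omega) loop).Loopable (B.e (i + 1)) (B.coeff (i + 1)) where
  le := coeff_mono i.le_succ
  y_mem := y_zpow_mem_coeff hi
  comm _ hw := coeff_e le_rfl hi' hw
  one_mem := by
    obtain ⟨a, ha⟩ := B.e_sq (i := i + 1) (by omega) hi'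
    refine StrandPair.mem_loopSubmodule.2 ⟨a • 1, Subalgebra.smul_mem _ (one_mem _) _, ?_⟩
    rw [mul_one, ha, mul_smul_comm, mul_one]
  X_mem := by
    refine StrandPair.mem_loopSubmodule.2
      ⟨((B.lam⁻¹ : Rˣ) : R) • 1, Subalgebra.smul_mem _ (one_mem _) _, ?_⟩
    change B.e (i + 1) * B.X i * B.e (i + 1) = _
    rw [mul_assoc, X_mul_e hi (by omega) (by omega) hi' (.inl rfl), mul_assoc, ← mul_assoc,
      StrandPair.mul_inv_of_mul_eq_smul (B.e_X (by omega) hi'), smul_mul_assoc, ← mul_assoc,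
      B.EEE (by omega) hi' hi (by omega) (.inr rfl), mul_smul_comm, mul_one]
  X_inv_mem := by
    refine StrandPair.mem_loopSubmodule.2
      ⟨(B.lam : R) • 1, Subalgebra.smul_mem _ (one_mem _) _, ?_⟩
    change B.e (i + 1) * (((B.X i)⁻¹ : Aˣ) : A) * B.e (i + 1) = _
    rw [mul_assoc, X_inv_mul_e hi (by omega) (by omega) hi' (.inl rfl), mul_assoc, ← mul_assoc,
      B.e_X (by omega) hi', smul_mul_assoc, ← mul_assoc,
      B.EEE (by omega) hi' hi (by omega) (.inr rfl), mul_smul_comm, mul_one]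
  f_e_f := B.EEE (by omega) hi' hi (by omega) (.inr rfl)
  conj c := by
    change B.e (i + 1) * (B.X i * ((B.y i ^ c : Aˣ) : A) * (((B.X i)⁻¹ : Aˣ) : A)) * B.e (i + 1)
      = B.e (i + 1) * (B.e i * ((B.y i ^ c : Aˣ) : A) * B.e i) * B.e (i + 1)
    have hX := (coeff_X le_rfl hi' (y_zpow_mem_coeff (B := B) hi c)).eq
    calc _ = B.e (i + 1) * B.X i * ((B.y i ^ c : Aˣ) : A)
          * ((((B.X i)⁻¹ : Aˣ) : A) * B.e (i + 1)) := by simp only [mul_assoc]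
      _ = B.e (i + 1) * B.e i * (((B.X (i + 1))⁻¹ : Aˣ) : A)
          * (((B.y i ^ c : Aˣ) : A) * B.X (i + 1)) * B.e i * B.e (i + 1) := by
        rw [X_inv_mul_e hi (by omega) (by omega) hi' (.inl rfl),
          e_mul_X hi (by omega) (by omega) hi' (.inl rfl)]
        simp only [mul_assoc]
      _ = _ := by
        rw [hX, ← mul_assoc, Units.inv_mul_cancel_right]
        simp only [mul_assoc]
  conj_inv c := by
    change B.e (i + 1) * ((((B.X i)⁻¹ : Aˣ) : A) * ((B.y i ^ c : Aˣ) : A) * B.X i) * B.e (i + 1)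
      = B.e (i + 1) * (B.e i * ((B.y i ^ c : Aˣ) : A) * B.e i) * B.e (i + 1)
    have hX := (coeff_X le_rfl hi' (y_zpow_mem_coeff (B := B) hi c)).eq
    calc _ = B.e (i + 1) * (((B.X i)⁻¹ : Aˣ) : A) * ((B.y i ^ c : Aˣ) : A)
          * (B.X i * B.e (i + 1)) := by simp only [mul_assoc]
      _ = B.e (i + 1) * B.e i * (B.X (i + 1) * ((B.y i ^ c : Aˣ) : A))
          * (((B.X (i + 1))⁻¹ : Aˣ) : A) * B.e i * B.e (i + 1) := by
        rw [X_mul_e hi (by omega) (by omega) hi' (.inl rfl),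
          e_mul_X_inv hi (by omega) (by omega) hi' (.inl rfl)]
        simp only [mul_assoc]
      _ = _ := by
        rw [← hX, ← mul_assoc, Units.mul_inv_cancel_right]
        simp only [mul_assoc]

lemma loop {i : ℕ} (hi : 1 ≤ i) (hi' : i ≤ B.r) (c : ℤ) :
    ∃ w ∈ B.coeff i, B.e i * ((B.y i ^ c : Aˣ) : A) * B.e i = B.e i * w := by
  induction i, hi using Nat.le_induction generalizing c with
  | base =>
    obtain ⟨a, ha⟩ := B.EYE hi' c
    exact ⟨a • 1, Subalgebra.smul_mem _ (one_mem _) _, by rw [mul_smul_comm, mul_one]; exact ha⟩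
  | succ i hi ih =>
    exact (pair_loopable hi hi' fun c => ih (by omega) c).exists_loop c

section Tails

variable (B)

/-- `X i X (i+1) ⋯ X (i+d-1)`. -/
def Xs (i : ℕ) : ℕ → A
  | 0 => 1
  | d + 1 => B.X i * Xs (i + 1) d

/-- `e i e (i+1) ⋯ e (i+d-1)`. -/
def es (i : ℕ) : ℕ → A
  | 0 => 1
  | d + 1 => B.e i * es (i + 1) d

variable {B}

lemma Xs_succ (i d : ℕ) : B.Xs i (d + 1) = B.X i * B.Xs (i + 1) d := rfl

lemma es_succ (i d : ℕ) : B.es i (d + 1) = B.e i * B.es (i + 1) d := rfl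

lemma Xs_add (i d d' : ℕ) : B.Xs i (d + d') = B.Xs i d * B.Xs (i + d) d' := by
  induction d generalizing i with
  | zero => simp [Xs]
  | succ d ih =>
    rw [add_right_comm, Xs_succ, Xs_succ, ih, mul_assoc, add_right_comm, ← add_assoc]

lemma es_add (i d d' : ℕ) : B.es i (d + d') = B.es i d * B.es (i + d) d' := by
  induction d generalizing i with
  | zero => simp [es]
  | succ d ih =>
    rw [add_right_comm, es_succ, es_succ, ih, mul_assoc, add_right_comm, ← add_assoc]

lemma commute_Xs {x : A} {i d : ℕ} (h : ∀ t, i ≤ t → t < i + d → Commute x (B.X t : A)) :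
    Commute x (B.Xs i d) := by
  induction d generalizing i with
  | zero => exact Commute.one_right x
  | succ d ih =>
    exact (h i le_rfl (by omega)).mul_right (ih fun t ht ht' => h t (by omega) (by omega))

lemma commute_es {x : A} {i d : ℕ} (h : ∀ t, i ≤ t → t < i + d → Commute x (B.e t)) :
    Commute x (B.es i d) := by
  induction d generalizing i with
  | zero => exact Commute.one_right x
  | succ d ih =>
    exact (h i le_rfl (by omega)).mul_right (ih fun t ht ht' => h t (by omega) (by omega))

lemma Xs_mem {i d l : ℕ} (hi : 1 ≤ i) (h : i + d ≤ l) : B.Xs i d ∈ B.sub l := by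
  induction d generalizing i with
  | zero => exact one_mem _
  | succ d ih => exact mul_mem (X_mem hi (by omega)) (ih (by omega) (by omega))

lemma es_mem {i d l : ℕ} (hi : 1 ≤ i) (h : i + d ≤ l) : B.es i d ∈ B.sub l := by
  induction d generalizing i with
  | zero => exact one_mem _
  | succ d ih => exact mul_mem (e_mem hi (by omega)) (ih (by omega) (by omega))

lemma exists_e_mul_Xs_es {s d c : ℕ} (hs : 1 ≤ s) (h : s + d + c + 1 ≤ B.r) :
    ∃ b ∈ B.sub (s + d + c), B.e s * (B.Xs (s + 1) d * B.es (s + 1 + d) (c + 1))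
      = B.es s (d + c + 2) * b := by
  induction d generalizing s with
  | zero => exact ⟨1, one_mem _, by simp [Xs, es_succ]⟩
  | succ d ih =>
    obtain ⟨b, hb, h'⟩ := ih (s := s + 1) (by omega) (by omega)
    have hc : Commute (((B.X s)⁻¹ : Aˣ) : A)
        (B.Xs (s + 2) d * B.es (s + 2 + d) (c + 1)) := by
      refine (Commute.mul_right (commute_Xs fun t _ _ => ?_)
        (commute_es fun t _ _ => ?_))
      · exact (commute_X_X hs (by omega) (by omega) (by omega) (by omega)).units_inv_left
      · exact (B.XE_far hs (by omega) (by omega) (by omega) (by omega)).units_inv_left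
    refine ⟨b * (((B.X s)⁻¹ : Aˣ) : A),
      mul_mem (sub_mono (by omega) hb) (X_inv_mem hs (by omega)), ?_⟩
    rw [Xs_succ, mul_assoc, ← mul_assoc (B.e s),
      e_mul_X (by omega) (by omega) hs (by omega) (.inr rfl), mul_assoc,
      show s + 1 + (d + 1) = s + 2 + d by omega, hc.eq, mul_assoc,
      ← mul_assoc (B.e (s + 1)), h', show d + 1 + c + 2 = d + c + 2 + 1 by omega,
      es_succ s, mul_assoc, mul_assoc]

end Tails

variable (B) in
/-- `(y i)^p X i ⋯ X (i+d-1) e (i+d) ⋯ e (i+d+c)`. -/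
def alpha (i d c : ℕ) (p : ℤ) : A :=
  ((B.y i ^ p : Aˣ) : A) * (B.Xs i d * B.es (i + d) (c + 1))

variable (B) in
/-- The span in which the products of a generator with index `m` and `alpha i d c p`, `i+d+c = l`,
are shown to lie. -/
def target (i l m : ℕ) (p : ℤ) : Submodule R A := Submodule.span R
  {x | ∃ (i' d' c' : ℕ) (p' : ℤ) (b : A), 1 ≤ i' ∧ i' + d' + c' = l ∧ b ∈ B.sub (l - 1) ∧
    min i m ≤ i' ∧ |p'| ≤ |p| ∧ (0 ≤ p' * p ∨ i' = m) ∧ x = B.alpha i' d' c' p' * b}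

lemma alpha_mul_mem_target {i m i' d' c' l : ℕ} {p p' : ℤ} (b : A) (h1 : 1 ≤ i')
    (hl : i' + d' + c' = l) (hb : b ∈ B.sub (l - 1)) (hi : min i m ≤ i') (hp : |p'| ≤ |p|)
    (hs : 0 ≤ p' * p ∨ i' = m) : B.alpha i' d' c' p' * b ∈ B.target i l m p :=
  Submodule.subset_span ⟨i', d', c', p', b, h1, hl, hb, hi, hp, hs, rfl⟩

lemma alpha_zero_mul_mem_target {i m i' d' c' l : ℕ} {p : ℤ} (b : A) (h1 : 1 ≤ i')
    (hl : i' + d' + c' = l) (hb : b ∈ B.sub (l - 1)) (hi : min i m ≤ i') :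
    B.Xs i' d' * B.es (i' + d') (c' + 1) * b ∈ B.target i l m p := by
  have := alpha_mul_mem_target (p := p) (p' := 0) b h1 hl hb hi (by simp) (by simp)
  rwa [alpha, zpow_zero, Units.val_one, one_mul] at this

lemma T_mul_tail_mem {m d c l i : ℕ} {p : ℤ} (hm : 1 ≤ m) (hl : m + 1 + d + c = l) (hr : l ≤ B.r)
    {x : A} (hx : x ∈ (B.pair hm (by omega) (loop hm (by omega))).T p) :
    x * (B.Xs (m + 1) d * B.es (m + 1 + d) (c + 1)) ∈ B.target i l m p := by
  set t := B.Xs (m + 1) d * B.es (m + 1 + d) (c + 1) with ht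
  have ht' {w : A} (hw : w ∈ B.coeff (m + 1)) : Commute w t :=
    (commute_Xs fun u _ _ => coeff_X (by omega) (by omega) hw).mul_right
      (commute_es fun u _ _ => coeff_e (by omega) (by omega) hw)
  have hsub {w : A} (hw : w ∈ B.coeff (m + 1)) : w ∈ B.sub (l - 1) :=
    sub_mono (by omega) (coeff_le_sub _ hw)
  refine StrandPair.mem_mul_of_forall _ ?_ hx
  rintro _ ((⟨a, b, h, h', rfl⟩ | ⟨a, b, h, rfl⟩) | ⟨a, b, h, w, hw, rfl⟩)
  · change ((B.y (m + 1) ^ a : Aˣ) : A) * ((B.y m ^ b : Aˣ) : A) * t ∈ _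
    have hb := y_zpow_mem_coeff (B := B) hm b
    rw [mul_assoc, (ht' hb).eq, ← mul_assoc]
    exact alpha_mul_mem_target _ (by omega) hl (hsub hb) (by omega) h (.inl h')
  · change ((B.y m ^ a : Aˣ) : A) * B.X m * ((B.y m ^ b : Aˣ) : A) * t ∈ _
    have hb := y_zpow_mem_coeff (B := B) hm b
    rw [mul_assoc, (ht' hb).eq, ← mul_assoc, mul_assoc _ _ t, ht, ← mul_assoc (B.X m : A),
      ← Xs_succ, add_right_comm m]
    exact alpha_mul_mem_target (d' := d + 1) _ hm (by omega) (hsub hb) (min_le_right _ _) h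
      (.inr rfl)
  · change ((B.y m ^ a : Aˣ) : A) * B.e m * ((B.y m ^ b : Aˣ) : A) * w * t ∈ _
    have hb := mul_mem (y_zpow_mem_coeff (B := B) hm b) (coeff_mono m.le_succ hw)
    obtain ⟨b', hb', he⟩ := exists_e_mul_Xs_es (B := B) (s := m) (d := d) (c := c) hm (by omega)
    rw [mul_assoc _ _ w, mul_assoc, (ht' hb).eq, ← mul_assoc, mul_assoc _ _ t, he, ← mul_assoc,
      mul_assoc]
    have := alpha_mul_mem_target (B := B) (i := i) (m := m) (d' := 0) (c' := d + c + 1) (l := l)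
      (p := p) (p' := a) _ hm (by omega) (mul_mem (sub_mono (by omega) hb') (hsub hb))
      (min_le_right _ _) h (.inr rfl)
    rw [alpha, Xs, one_mul, add_zero] at this
    simpa only [mul_assoc] using this

lemma G_mul_tail_mem {m c l : ℕ} {p : ℤ} (hm : 1 ≤ m) (hl : m + c = l) (hr : l ≤ B.r)
    {x : A} (hx : x ∈ (B.pair hm (by omega) (loop hm (by omega))).G p.natAbs) :
    x * B.es (m + 1) c ∈ B.target m l m p := by
  refine StrandPair.mem_mul_of_forall _ ?_ hx
  rintro _ ⟨a, h, w, hw, rfl⟩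
  change ((B.y m ^ a : Aˣ) : A) * B.e m * w * B.es (m + 1) c ∈ _
  have hc : Commute w (B.es (m + 1) c) :=
    commute_es fun u _ _ => coeff_e (by omega) (by omega) hw
  rw [mul_assoc, hc.eq, ← mul_assoc, mul_assoc _ (B.e m), ← es_succ]
  have := alpha_mul_mem_target (B := B) (i := m) (m := m) (d' := 0) (c' := c) (l := l)
    (p := p) (p' := a) w hm (by omega) (sub_mono (by omega) (coeff_le_sub _ hw))
    (min_le_right _ _) (by rwa [Int.abs_eq_natAbs p]) (.inr rfl)
  rwa [alpha, Xs, one_mul, add_zero] at this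

lemma commute_gen_y {m i : ℕ} (hm : 1 ≤ m) (hm' : m ≤ B.r) (hi : 1 ≤ i) (hi' : i ≤ B.r + 1)
    (h : m ≠ i) (h' : m + 1 ≠ i) {g : A} (hg : g = B.X m ∨ g = B.e m) (p : ℤ) :
    Commute g ((B.y i ^ p : Aˣ) : A) := by
  rcases hg with rfl | rfl
  · exact (commute_X_y hm hm' hi hi' h h').units_zpow_right p
  · exact (commute_e_y hm hm' hi hi' h h').units_zpow_right p

lemma commute_gen_X {m i : ℕ} (hm : 1 ≤ m) (hm' : m ≤ B.r) (hi : 1 ≤ i) (hi' : i ≤ B.r)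
    (h : m + 2 ≤ i ∨ i + 2 ≤ m) {g : A} (hg : g = B.X m ∨ g = B.e m) :
    Commute g (B.X i : A) := by
  rcases hg with rfl | rfl
  · exact commute_X_X hm hm' hi hi' h
  · exact (B.XE_far hi hi' hm hm' h.symm).symm

lemma commute_gen_e {m i : ℕ} (hm : 1 ≤ m) (hm' : m ≤ B.r) (hi : 1 ≤ i) (hi' : i ≤ B.r)
    (h : m + 2 ≤ i ∨ i + 2 ≤ m) {g : A} (hg : g = B.X m ∨ g = B.e m) :
    Commute g (B.e i) := by
  rcases hg with rfl | rfl
  · exact B.XE_far hm hm' hi hi' h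
  · exact commute_e_e hm hm' hi hi' h

lemma gen_mem {m l : ℕ} (hm : 1 ≤ m) (h : m + 1 ≤ l) {g : A} (hg : g = B.X m ∨ g = B.e m) :
    g ∈ B.sub l := by
  rcases hg with rfl | rfl
  · exact X_mem hm h
  · exact e_mem hm h

variable {i d c l m : ℕ} {p : ℤ} {g : A}

lemma gen_mul_alpha_of_far_below (hi : m + 2 ≤ i) (hl : i + d + c = l) (hr : l ≤ B.r)
    (hm : 1 ≤ m) (hg : g = B.X m ∨ g = B.e m) : g * B.alpha i d c p ∈ B.target i l m p := by
  have h : Commute g (B.alpha i d c p) :=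
    (commute_gen_y hm (by omega) (by omega) (by omega) (by omega) (by omega) hg p).mul_right
      ((commute_Xs fun t _ _ => commute_gen_X hm (by omega) (by omega) (by omega) (by omega)
        hg).mul_right (commute_es fun t _ _ => commute_gen_e hm (by omega) (by omega) (by omega)
        (by omega) hg))
  rw [h.eq]
  exact alpha_mul_mem_target _ (by omega) hl (gen_mem hm (by omega) hg) (min_le_left _ _) le_rfl
    (.inl (mul_self_nonneg p))

lemma gen_mul_alpha_of_succ (hl : m + 1 + d + c = l) (hr : l ≤ B.r)
    (hm : 1 ≤ m) (hg : g = B.X m ∨ g = B.e m) :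
    g * B.alpha (m + 1) d c p ∈ B.target (m + 1) l m p := by
  rw [alpha, ← mul_assoc]
  refine T_mul_tail_mem hm hl hr ?_
  rcases hg with rfl | rfl
  · exact StrandPair.X_mul_z_zpow_mem_T (S := B.pair hm _ _) p
  · exact StrandPair.e_mul_z_zpow_mem_T (S := B.pair hm _ _) p

lemma gen_mul_alpha_self (hl : m + d + c = l) (hr : l ≤ B.r)
    (hm : 1 ≤ m) (hg : g = B.X m ∨ g = B.e m) : g * B.alpha m d c p ∈ B.target m l m p := by
  cases d with
  | zero =>
    rw [alpha, Xs, one_mul, add_zero, es_succ, ← mul_assoc, ← mul_assoc]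
    refine G_mul_tail_mem hm (by omega) hr ?_
    rcases hg with rfl | rfl
    · exact StrandPair.X_y_zpow_e_mem_G (S := B.pair hm _ _) p
    · exact StrandPair.G_mono (Nat.zero_le _) (StrandPair.e_y_e_mem_G (S := B.pair hm _ _) p)
  | succ d =>
    rw [alpha, Xs_succ, mul_assoc (B.X m : A), ← mul_assoc, ← mul_assoc, add_comm d,
      ← add_assoc m]
    refine T_mul_tail_mem hm (by omega) hr ?_
    rcases hg with rfl | rfl
    · exact StrandPair.X_y_zpow_X_mem_T (S := B.pair hm _ _) p
    · exact StrandPair.e_y_zpow_X_mem_T (S := B.pair hm _ _) p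

/-- Left multiplication by a generator acting on the interior of the run of crossings. -/
lemma gen_mul_alpha_of_lt (hi : 1 ≤ i) (him : i < m) (hmd : m < i + d) (hl : i + d + c = l)
    (hr : l ≤ B.r) (hg : g = B.X m ∨ g = B.e m) : g * B.alpha i d c p ∈ B.target i l m p := by
  obtain ⟨u, rfl⟩ : ∃ u, m = i + u + 1 := ⟨m - i - 1, by omega⟩
  obtain ⟨v, rfl⟩ : ∃ v, d = u + (v + 2) := ⟨d - u - 2, by omega⟩
  obtain ⟨g', hg', hgg'⟩ : ∃ g' : A, (g' = B.X (i + u) ∨ g' = B.e (i + u)) ∧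
      g * (B.X (i + u) * B.X (i + u + 1)) = B.X (i + u) * B.X (i + u + 1) * g' := by
    rcases hg with rfl | rfl
    · exact ⟨_, .inl rfl, by rw [← mul_assoc, B.braid (by omega) (by omega)]⟩
    · exact ⟨_, .inr rfl, e_succ_mul_X_X (by omega) (by omega)⟩
  have h1 : Commute g ((B.y i ^ p : Aˣ) : A) :=
    commute_gen_y (by omega) (by omega) hi (by omega) (by omega) (by omega) hg p
  have h2 : Commute g (B.Xs i u) := commute_Xs fun t _ _ =>
    commute_gen_X (by omega) (by omega) (by omega) (by omega) (by omega) hg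
  have h3 : Commute g' (B.Xs (i + u + 1 + 1) v * B.es (i + (u + (v + 2))) (c + 1)) :=
    (commute_Xs fun t _ _ => commute_gen_X (by omega) (by omega) (by omega) (by omega) (by omega)
      hg').mul_right (commute_es fun t _ _ => commute_gen_e (by omega) (by omega) (by omega)
        (by omega) (by omega) hg')
  have key : g * B.alpha i (u + (v + 2)) c p = B.alpha i (u + (v + 2)) c p * g' := by
    have hα : B.alpha i (u + (v + 2)) c p = ((B.y i ^ p : Aˣ) : A) * B.Xs i u
        * (B.X (i + u) * B.X (i + u + 1))
        * (B.Xs (i + u + 1 + 1) v * B.es (i + (u + (v + 2))) (c + 1)) := by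
      rw [alpha, Xs_add, Xs_succ, Xs_succ]
      simp only [mul_assoc]
    rw [hα, mul_assoc _ _ g', ← h3.eq, ← mul_assoc, ← mul_assoc, ← mul_assoc, (h1.mul_right h2).eq,
      mul_assoc _ g, hgg']
    simp only [mul_assoc]
  rw [key]
  exact alpha_mul_mem_target _ hi hl (gen_mem (by omega) (by omega) hg') (min_le_left _ _) le_rfl
    (.inl (mul_self_nonneg p))

/-- Left multiplication by a generator acting where crossings and cup-caps meet. -/
lemma gen_mul_alpha_of_eq (hi : 1 ≤ i) (hl : i + (d + 1) + c = l) (hr : l ≤ B.r)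
    (hg : g = B.X (i + (d + 1)) ∨ g = B.e (i + (d + 1))) :
    g * B.alpha i (d + 1) c p ∈ B.target i l (i + (d + 1)) p := by
  have h1 : Commute g ((B.y i ^ p : Aˣ) : A) :=
    commute_gen_y (by omega) (by omega) hi (by omega) (by omega) (by omega) hg p
  have h2 : Commute g (B.Xs i d) := commute_Xs fun t _ _ =>
    commute_gen_X (by omega) (by omega) (by omega) (by omega) (by omega) hg
  set y := ((B.y i ^ p : Aˣ) : A) with hy
  set j := i + (d + 1) with hj
  have key : g * B.alpha i (d + 1) c p
      = y * B.Xs i d * (g * (B.X (i + d) * B.e j)) * B.es (j + 1) c := by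
    rw [alpha, Xs_add, Xs_succ, Xs, mul_one, es_succ, ← mul_assoc, ← mul_assoc, ← mul_assoc,
      ← mul_assoc, h1.eq, mul_assoc _ g, h2.eq]
    simp only [mul_assoc, ← hj]
  rw [key]
  rcases hg with rfl | rfl
  · have h : (B.X j : A) * (B.X (i + d) * B.e j) = B.e (i + d) * B.e j := by
      rw [← mul_assoc, B.XXE (by omega) (by omega) (by omega) (by omega) (by omega)]
    have := alpha_mul_mem_target (B := B) (i := i) (m := j) (d' := d) (c' := c + 1) (l := l)
      (p := p) 1 hi (by omega) (one_mem _) (min_le_left _ _) le_rfl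
      (.inl (mul_self_nonneg p))
    rw [mul_one, alpha, ← hy, es_succ, es_succ, show i + d + 1 = j from rfl] at this
    rw [h]
    simpa only [mul_assoc] using this
  · have h : B.e j * (B.X (i + d) * B.e j) = ((B.lam⁻¹ : Rˣ) : R) • B.e j := by
      rw [X_mul_e (by omega) (by omega) (by omega) (by omega) (by omega), mul_assoc, ← mul_assoc,
        StrandPair.mul_inv_of_mul_eq_smul (B.e_X (by omega) (by omega)), smul_mul_assoc,
        ← mul_assoc, B.EEE (by omega) (by omega) (by omega) (by omega) (by omega)]
    have hc : Commute (y * B.Xs i d) (B.es j (c + 1)) := by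
      refine commute_es fun t _ _ => Commute.mul_left ?_ ?_
      · exact (commute_gen_y (by omega) (by omega) hi (by omega) (by omega) (by omega)
          (.inr rfl) p).symm
      · exact (commute_Xs fun u _ _ => commute_gen_X (by omega) (by omega) (by omega) (by omega)
          (by omega) (.inr rfl)).symm
    rw [h, mul_smul_comm, smul_mul_assoc, mul_assoc, ← es_succ, hc.eq]
    have := alpha_zero_mul_mem_target (B := B) (i := i) (m := j) (i' := j) (d' := 0) (c' := c)
      (l := l) (p := p) (y * B.Xs i d) (by omega) (by omega)
      (mul_mem (y_zpow_mem hi (by omega) p) (Xs_mem hi (by omega))) (min_le_right _ _)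
    rw [Xs, one_mul, add_zero] at this
    exact Submodule.smul_mem _ _ this

/-- Left multiplication by a generator acting on the interior of the run of cup-caps. -/
lemma gen_mul_alpha_of_gt (hi : 1 ≤ i) (hmd : i + d < m) (hl : i + d + c = l) (hm : m ≤ l)
    (hr : l ≤ B.r) (hg : g = B.X m ∨ g = B.e m) : g * B.alpha i d c p ∈ B.target i l m p := by
  obtain ⟨u, hu⟩ : ∃ u, m = i + d + u + 1 := ⟨m - (i + d) - 1, by omega⟩
  obtain ⟨v, rfl⟩ : ∃ v, c = u + (v + 1) := ⟨c - u - 1, by omega⟩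
  have h1 : Commute g ((B.y i ^ p : Aˣ) : A) :=
    commute_gen_y (by omega) (by omega) hi (by omega) (by omega) (by omega) hg p
  have h2 : Commute g (B.Xs i d) := commute_Xs fun t _ _ =>
    commute_gen_X (by omega) (by omega) (by omega) (by omega) (by omega) hg
  have h3 : Commute g (B.es (i + d) u) := commute_es fun t _ _ =>
    commute_gen_e (by omega) (by omega) (by omega) (by omega) (by omega) hg
  set U := ((B.y i ^ p : Aˣ) : A) * B.Xs i d * B.es (i + d) u with hU
  have hgU : Commute g U := (h1.mul_right h2).mul_right h3
  have hα : B.alpha i d (u + (v + 1)) p = U * (B.e (m - 1) * B.e m) * B.es (m + 1) v := by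
    rw [alpha, add_assoc u, es_add, es_succ, es_succ, ← hu, show i + d + u = m - 1 by omega]
    simp only [hU, mul_assoc]
  have hUe : U * B.es m (v + 1) ∈ B.target i l m p := by
    have hc : Commute U (B.es m (v + 1)) := by
      refine commute_es fun t _ _ => Commute.mul_left (Commute.mul_left ?_ ?_) ?_
      · exact (commute_gen_y (by omega) (by omega) hi (by omega) (by omega) (by omega)
          (.inr rfl) p).symm
      · exact (commute_Xs fun u _ _ => commute_gen_X (by omega) (by omega) (by omega) (by omega)
          (by omega) (.inr rfl)).symm
      · exact (commute_es fun u _ _ => commute_gen_e (by omega) (by omega) (by omega) (by omega)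
          (by omega) (.inr rfl)).symm
    rw [hc.eq]
    have := alpha_zero_mul_mem_target (B := B) (i := i) (m := m) (i' := m) (d' := 0) (c' := v)
      (l := l) (p := p) U (by omega) (by omega)
      (mul_mem (mul_mem (y_zpow_mem hi (by omega) p) (Xs_mem hi (by omega)))
        (es_mem (by omega) (by omega))) (min_le_right _ _)
    rwa [Xs, one_mul, add_zero] at this
  have hUX : U * B.X (m - 1) * B.es m (v + 1) ∈ B.target i l m p := by
    cases u with
    | zero =>
      have := alpha_mul_mem_target (B := B) (i := i) (m := m) (d' := d + 1) (c' := v) (l := l)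
        (p := p) 1 hi (by omega) (one_mem _) (min_le_left _ _) le_rfl (.inl (mul_self_nonneg p))
      rw [mul_one, alpha, Xs_add, Xs_succ, Xs, mul_one, show i + (d + 1) = m by omega,
        show i + d = m - 1 by omega] at this
      simpa only [hU, es, mul_one, mul_assoc] using this
    | succ u =>
      have hc : Commute (((B.X (m - 2))⁻¹ : Aˣ) : A) (B.es m (v + 1)) :=
        commute_es fun t _ _ =>
          (B.XE_far (by omega) (by omega) (by omega) (by omega) (by omega)).units_inv_left
      have hUU : U = ((B.y i ^ p : Aˣ) : A) * B.Xs i d * B.es (i + d) u * B.e (m - 2) := by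
        rw [hU, es_add, es_succ, es, mul_one, show i + d + u = m - 2 by omega]
        simp only [mul_assoc]
      have key : U * B.X (m - 1) * B.es m (v + 1)
          = B.alpha i d (u + 1 + (v + 1)) p * (((B.X (m - 2))⁻¹ : Aˣ) : A) := by
        have he : B.e (m - 2) * (B.X (m - 1) : A)
            = B.e (m - 2) * B.e (m - 1) * (((B.X (m - 2))⁻¹ : Aˣ) : A) :=
          e_mul_X (by omega) (by omega) (by omega) (by omega) (by omega)
        rw [hα, hUU]
        generalize ((B.y i ^ p : Aˣ) : A) * B.Xs i d * B.es (i + d) u = V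
        calc V * B.e (m - 2) * B.X (m - 1) * B.es m (v + 1)
            = V * B.e (m - 2) * B.e (m - 1)
                * ((((B.X (m - 2))⁻¹ : Aˣ) : A) * B.es m (v + 1)) := by
              rw [mul_assoc V, he]
              simp only [mul_assoc]
          _ = V * B.e (m - 2) * (B.e (m - 1) * B.e m) * B.es (m + 1) v
                * (((B.X (m - 2))⁻¹ : Aˣ) : A) := by
              rw [hc.eq, es_succ]
              simp only [mul_assoc]
      rw [key]
      exact alpha_mul_mem_target _ hi hl (X_inv_mem (by omega) (by omega)) (min_le_left _ _) le_rfl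
        (.inl (mul_self_nonneg p))
  rw [hα, ← mul_assoc, ← mul_assoc, hgU.eq]
  rcases hg with rfl | rfl
  · have hα' := alpha_mul_mem_target (B := B) (i := i) (m := m) (d' := d) (c' := u + (v + 1))
      (l := l) (p := p) 1 hi hl (one_mem _) (min_le_left _ _) le_rfl (.inl (mul_self_nonneg p))
    rw [mul_one, hα] at hα'
    have hX : (((B.X (m - 1))⁻¹ : Aˣ) : A)
        = B.X (m - 1) - B.δ • 1 + B.δ • B.e (m - 1) := by
      have := B.skein (i := m - 1) (by omega) (by omega)
      rw [smul_sub] at this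
      rw [← sub_sub_cancel (B.X (m - 1) : A) (((B.X (m - 1))⁻¹ : Aˣ) : A), this]
      abel
    have h : (B.X m : A) * (B.e (m - 1) * B.e m) = (((B.X (m - 1))⁻¹ : Aˣ) : A) * B.e m := by
      rw [X_inv_mul_e (by omega) (by omega) (by omega) (by omega) (by omega), mul_assoc]
    rw [mul_assoc U, h, mul_assoc U, mul_assoc _ (B.e m), ← es_succ, hX]
    have := add_mem (sub_mem hUX (Submodule.smul_mem _ B.δ hUe)) (Submodule.smul_mem _ B.δ hα')
    convert this using 1
    simp only [mul_add, mul_sub, add_mul, sub_mul, smul_mul_assoc, mul_smul_comm, one_mul,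
      mul_assoc, es_succ]
  · rw [mul_assoc U, ← mul_assoc (B.e m), B.EEE (by omega) (by omega) (by omega) (by omega)
      (by omega), mul_assoc, ← es_succ]
    exact hUe

theorem gen_mul_alpha_mem_target (hi : 1 ≤ i) (hl : i + d + c = l) (hr : l ≤ B.r) (hm : 1 ≤ m)
    (hml : m ≤ l) (hg : g = B.X m ∨ g = B.e m) : g * B.alpha i d c p ∈ B.target i l m p := by
  obtain h | rfl | rfl | h : m + 2 ≤ i ∨ m + 1 = i ∨ m = i ∨ i < m := by omega
  · exact gen_mul_alpha_of_far_below h hl hr hm hg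
  · exact gen_mul_alpha_of_succ hl hr hm hg
  · exact gen_mul_alpha_self hl hr hm hg
  · obtain h' | h' | h' := lt_trichotomy m (i + d)
    · exact gen_mul_alpha_of_lt hi h h' hl hr hg
    · subst h'
      obtain ⟨d, rfl⟩ := Nat.exists_eq_succ_of_ne_zero (by omega : d ≠ 0)
      exact gen_mul_alpha_of_eq hi hl hr hg
    · exact gen_mul_alpha_of_gt hi h' hl hml hr hg

end AffineBMW

namespace CBMW

variable {R : Type} [CommRing R] (P : Params R)

variable {P} in
lemma pr_rel {a b : F R} (h : Rel P a b) : pr P a = pr P b := RingQuot.mkAlgHom_rel R h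

lemma X_mul_Xi (i : ℕ) : Xg P i * Xgi P i = 1 := by
  by_cases h : 1 ≤ i ∧ i ≤ P.n - 1
  · have h := pr_rel (Rel.X_inv_right (P := P) h.1 h.2)
    simp only [map_mul, map_one] at h
    exact h
  · have h1 := pr_rel (Rel.X_invalid (P := P) (i := i) (by omega))
    have h2 := pr_rel (Rel.Xi_invalid (P := P) (i := i) (by omega))
    rw [Xg, Xgi, h1, h2, map_one, one_mul]

lemma Xi_mul_X (i : ℕ) : Xgi P i * Xg P i = 1 := by
  by_cases h : 1 ≤ i ∧ i ≤ P.n - 1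
  · have h := pr_rel (Rel.X_inv_left (P := P) h.1 h.2)
    simp only [map_mul, map_one] at h
    exact h
  · have h1 := pr_rel (Rel.X_invalid (P := P) (i := i) (by omega))
    have h2 := pr_rel (Rel.Xi_invalid (P := P) (i := i) (by omega))
    rw [Xg, Xgi, h1, h2, map_one, one_mul]

/-- The generator `X i` as a unit. -/
def Xunit (i : ℕ) : (Alg P)ˣ := ⟨Xg P i, Xgi P i, X_mul_Xi P i, Xi_mul_X P i⟩

/-- The generator `Y` as a unit. -/
def Yunit : (Alg P)ˣ where
  val := Yg P
  inv := Ygi P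
  val_inv := by
    have h := pr_rel (Rel.Y_inv_right (P := P))
    simp only [map_mul, map_one] at h
    exact h
  inv_val := by
    have h := pr_rel (Rel.Y_inv_left (P := P))
    simp only [map_mul, map_one] at h
    exact h

/-- The span of the powers `1, Y, …, Y^(k-1)`. -/
def Yspan : Submodule R (Alg P) := Submodule.span R {x | ∃ m < P.k, x = Yg P ^ m}

lemma Y_pow_k : Yg P ^ P.k = ∑ i ∈ Finset.range P.k, P.qc i • Yg P ^ i := by
  have h := pr_rel (Rel.cyclo (P := P))
  simp only [map_pow, map_sum, map_smul] at h
  exact h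

variable {P}

lemma Y_pow_mem_Yspan {m : ℕ} (hm : m < P.k) : Yg P ^ m ∈ Yspan P :=
  Submodule.subset_span ⟨m, hm, rfl⟩

lemma Y_mul_mem_Yspan {x : Alg P} (hx : x ∈ Yspan P) : Yg P * x ∈ Yspan P := by
  induction hx using Submodule.span_induction with
  | mem x hx =>
    obtain ⟨m, hm, rfl⟩ := hx
    rw [← pow_succ']
    obtain h | h := Nat.lt_or_ge (m + 1) P.k
    · exact Y_pow_mem_Yspan h
    · rw [show m + 1 = P.k by omega, Y_pow_k]
      exact sum_mem fun i hi =>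
        Submodule.smul_mem _ _ (Y_pow_mem_Yspan (Finset.mem_range.1 hi))
  | zero => rw [mul_zero]; exact zero_mem _
  | add x y _ _ hx hy => rw [mul_add]; exact add_mem hx hy
  | smul a x _ hx => rw [mul_smul_comm]; exact Submodule.smul_mem _ a hx

lemma Y_inv_mul_pow_succ (m : ℕ) : Ygi P * Yg P ^ (m + 1) = Yg P ^ m := by
  rw [pow_succ']
  exact (Yunit P).inv_mul_cancel_left _

lemma Y_inv_mem_Yspan (hk : 1 ≤ P.k) (hq0 : P.qc 0 = (P.q0 : R)) : Ygi P ∈ Yspan P := by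
  obtain ⟨k, hk⟩ := Nat.exists_eq_add_of_le' hk
  have h := congrArg (Ygi P * ·) (Y_pow_k P)
  simp only [hk, Finset.sum_range_succ', mul_add, Y_inv_mul_pow_succ, Finset.mul_sum,
    mul_smul_comm, pow_zero, mul_one, hq0] at h
  have h' : (P.q0 : R) • Ygi P ∈ Yspan P := by
    rw [← sub_eq_of_eq_add' h]
    exact sub_mem (Y_pow_mem_Yspan (by omega)) (sum_mem fun i hi =>
      Submodule.smul_mem _ _ (Y_pow_mem_Yspan (by have := Finset.mem_range.1 hi; omega)))
  have := Submodule.smul_mem _ ((P.q0⁻¹ : Rˣ) : R) h'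
  rwa [smul_smul, Units.inv_mul, one_smul] at this

lemma Y_inv_mul_mem_Yspan (hk : 1 ≤ P.k) (hq0 : P.qc 0 = (P.q0 : R)) {x : Alg P}
    (hx : x ∈ Yspan P) : Ygi P * x ∈ Yspan P := by
  induction hx using Submodule.span_induction with
  | mem x hx =>
    obtain ⟨m, hm, rfl⟩ := hx
    cases m with
    | zero => simpa using Y_inv_mem_Yspan hk hq0
    | succ m =>
      rw [Y_inv_mul_pow_succ]
      exact Y_pow_mem_Yspan (by omega)
  | zero => rw [mul_zero]; exact zero_mem _
  | add x y _ _ hx hy => rw [mul_add]; exact add_mem hx hy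
  | smul a x _ hx => rw [mul_smul_comm]; exact Submodule.smul_mem _ a hx

lemma Y_zpow_mem_Yspan (hk : 1 ≤ P.k) (hq0 : P.qc 0 = (P.q0 : R)) (c : ℤ) :
    ((Yunit P ^ c : (Alg P)ˣ) : Alg P) ∈ Yspan P := by
  induction c using Int.induction_on with
  | zero => exact Y_pow_mem_Yspan (m := 0) hk
  | succ c ih =>
    rw [add_comm, zpow_one_add]
    exact Y_mul_mem_Yspan ih
  | pred c ih =>
    rw [sub_eq_neg_add, zpow_add, zpow_neg_one]
    exact Y_inv_mul_mem_Yspan hk hq0 ih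

lemma exists_EYE (h : 2 ≤ P.n) {x : Alg P} (hx : x ∈ Yspan P) :
    ∃ a : R, Eg P 1 * x * Eg P 1 = a • Eg P 1 := by
  induction hx using Submodule.span_induction with
  | mem x hx =>
    obtain ⟨m, hm, rfl⟩ := hx
    refine ⟨P.A m, ?_⟩
    have h := pr_rel (Rel.EYE (P := P) (m := m) h (by omega))
    simp only [map_mul, map_pow, map_smul] at h
    exact h
  | zero => exact ⟨0, by simp⟩
  | add x y _ _ hx hy =>
    obtain ⟨a, ha⟩ := hx
    obtain ⟨b, hb⟩ := hy
    exact ⟨a + b, by rw [mul_add, add_mul, ha, hb, add_smul]⟩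
  | smul c x _ hx =>
    obtain ⟨a, ha⟩ := hx
    exact ⟨c * a, by rw [mul_smul_comm, smul_mul_assoc, ha, smul_smul]⟩

variable (P) in
/-- The cyclotomic BMW algebra as a representation of the affine one. -/
def affine (hk : 1 ≤ P.k) (hq0 : P.qc 0 = (P.q0 : R)) : AffineBMW R (Alg P) where
  r := P.n - 1
  δ := P.delta
  lam := P.lam
  X := Xunit P
  e := Eg P
  Y := Yunit P
  skein h1 h2 := by
    have h := pr_rel (Rel.skein (P := P) h1 h2)
    simp only [map_sub, map_smul, map_one] at h
    exact h
  XX_far h1 h h2 := by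
    have h := pr_rel (Rel.XX_far (P := P) h1 (by omega) (by omega) h2 (.inl h))
    simp only [map_mul] at h
    exact h
  XE_far h1 h2 h3 h4 h := by
    have h := pr_rel (Rel.XE_far (P := P) h1 h2 h3 h4 h)
    simp only [map_mul] at h
    exact h
  EE_far h1 h h2 := by
    have h := pr_rel (Rel.EE_far (P := P) h1 (by omega) (by omega) h2 (.inl h))
    simp only [map_mul] at h
    exact h
  braid h1 h2 := by
    have h := pr_rel (Rel.braid (P := P) h1 h2)
    simp only [map_mul] at h
    exact h
  X_e h1 h2 := by
    have h := pr_rel (Rel.untwist_right (P := P) h1 h2)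
    simp only [map_mul, map_smul] at h
    exact h
  e_X h1 h2 := by
    have h := pr_rel (Rel.untwist_left (P := P) h1 h2)
    simp only [map_mul, map_smul] at h
    exact h
  XXE h1 h2 h3 h4 h := by
    have h := pr_rel (Rel.XXE (P := P) h1 h2 h3 h4 h)
    simp only [map_mul] at h
    exact h
  EXX h1 h2 h3 h4 h := by
    have h := pr_rel (Rel.EXX (P := P) h1 h2 h3 h4 h)
    simp only [map_mul] at h
    exact h
  EEE h1 h2 h3 h4 h := by
    rcases h with rfl | rfl
    · have h := pr_rel (Rel.EEE_up (P := P) h1 h4)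
      simp only [map_mul] at h
      exact h
    · have h := pr_rel (Rel.EEE_down (P := P) h3 h2)
      simp only [map_mul] at h
      exact h
  e_sq h1 h2 := ⟨P.A 0, by
    have h := pr_rel (Rel.E_sq (P := P) h1 h2)
    simp only [map_mul, map_smul] at h
    exact h⟩
  braidB h := by
    have h := pr_rel (Rel.braidB (P := P) (by omega))
    simp only [map_mul] at h
    exact h
  YX h1 h2 := by
    have h := pr_rel (Rel.YX_comm (P := P) h1 h2)
    simp only [map_mul] at h
    exact h
  YE h1 h2 := by
    have h := pr_rel (Rel.YE_comm (P := P) h1 h2)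
    simp only [map_mul] at h
    exact h
  YXYE h := by
    have h := pr_rel (Rel.YXYE (P := P) (by omega))
    simp only [map_mul, map_smul] at h
    exact h
  EYXY h := by
    have h := pr_rel (Rel.EYXY (P := P) (by omega))
    simp only [map_mul, map_smul] at h
    exact h
  EYE h c := exists_EYE (by omega) (Y_zpow_mem_Yspan hk hq0 c)

variable (hk : 1 ≤ P.k) (hq0 : P.qc 0 = (P.q0 : R))

lemma Yp_eq {i : ℕ} (hi : 1 ≤ i) : Yp P i = ((affine P hk hq0).y i : Alg P) := by
  induction i, hi using Nat.le_induction with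
  | base => exact (mul_one _).trans (one_mul _)
  | succ i hi ih =>
    obtain ⟨i, rfl⟩ := Nat.exists_eq_add_of_le' hi
    rw [AffineBMW.y_succ_val hi, ← ih]
    change Xg P (i + 1) * downX P i * Yg P * (upX P i * Xg P (i + 1))
      = Xg P (i + 1) * (downX P i * Yg P * upX P i) * Xg P (i + 1)
    simp only [mul_assoc]

lemma YpInv_eq {i : ℕ} (hi : 1 ≤ i) :
    YpInv P i = ((((affine P hk hq0).y i)⁻¹ : (Alg P)ˣ) : Alg P) := by
  induction i, hi using Nat.le_induction with
  | base => exact (mul_one _).trans (one_mul _)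
  | succ i hi ih =>
    obtain ⟨i, rfl⟩ := Nat.exists_eq_add_of_le' hi
    rw [AffineBMW.y_succ hi, mul_inv_rev, mul_inv_rev, Units.val_mul, Units.val_mul, ← ih]
    change Xgi P (i + 1) * downXi P i * Ygi P * (upXi P i * Xgi P (i + 1))
      = Xgi P (i + 1) * (downXi P i * Ygi P * upXi P i * Xgi P (i + 1))
    simp only [mul_assoc]

lemma Ypow_eq {i : ℕ} (hi : 1 ≤ i) (p : ℤ) :
    Ypow P i p = (((affine P hk hq0).y i ^ p : (Alg P)ˣ) : Alg P) := by
  rw [Ypow, Yp_eq hk hq0 hi, YpInv_eq hk hq0 hi]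
  split_ifs with h
  · lift p to ℕ using h
    simp
  · obtain ⟨n, rfl⟩ : ∃ n : ℕ, p = -n := ⟨(-p).toNat, by omega⟩
    simp

lemma alpha_eq {i : ℕ} (hi : 1 ≤ i) (d c : ℕ) (p : ℤ) :
    alpha P i (i + d) (i + d + c) p = (affine P hk hq0).alpha i d c p := by
  have hX (i d : ℕ) : ((List.range' i d).map fun t => Xg P t).prod
      = (affine P hk hq0).Xs i d := by
    induction d generalizing i with
    | zero => rfl
    | succ d ih => rw [List.range'_succ, List.map_cons, List.prod_cons, ih]; rfl
  have hE (i d : ℕ) : ((List.range' i d).map fun t => Eg P t).prod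
      = (affine P hk hq0).es i d := by
    induction d generalizing i with
    | zero => rfl
    | succ d ih => rw [List.range'_succ, List.map_cons, List.prod_cons, ih]; rfl
  rw [alpha, AffineBMW.alpha, Ypow_eq hk hq0 hi, hX, hE, mul_assoc, Nat.add_sub_cancel_left,
    add_assoc _ c, Nat.add_sub_cancel_left]

end CBMW

/-- Lemma 7 of the paper. Left multiplication of `α_{ijl}^p` by a
generator `γ_m ∈ {X_m, e_m}` lands in the span of the `α_{i'j'l}^{p'} B_{l-1}` with
`i' ≥ min(i,m)`, `|p'| ≤ |p|` and `p'p ≥ 0` unless `i' = m`. -/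
theorem statement6 {R : Type} [CommRing R] (P : Params R)
    (hn : 1 ≤ P.n) (hk : 1 ≤ P.k) (hq0 : P.qc 0 = (P.q0 : R))
    (hcomp : (P.lam : R) - P.laminv = P.delta * (1 - P.A 0))
    (i j l m : ℕ) (p : ℤ)
    (hi : 1 ≤ i) (hij : i ≤ j) (hjl : j ≤ l) (hl : l ≤ P.n - 1)
    (hm1 : 1 ≤ m) (hml : m ≤ l)
    (γ : Alg P) (hγ : γ = Xg P m ∨ γ = Eg P m) :
    γ * alpha P i j l p ∈
      Submodule.span R
        {x : Alg P | ∃ (i' j' : ℕ) (p' : ℤ) (b : Alg P),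
          1 ≤ i' ∧ i' ≤ j' ∧ j' ≤ l ∧ b ∈ Bsub P (l - 1) ∧
          min i m ≤ i' ∧ |p'| ≤ |p| ∧ (0 ≤ p' * p ∨ i' = m) ∧
          x = alpha P i' j' l p' * b} := by
  obtain ⟨d, rfl⟩ := Nat.exists_eq_add_of_le hij
  obtain ⟨c, rfl⟩ := Nat.exists_eq_add_of_le hjl
  rw [alpha_eq hk hq0 hi]
  refine Submodule.span_mono ?_ (AffineBMW.gen_mul_alpha_mem_target (B := affine P hk hq0) hi rfl
    hl hm1 hml hγ)
  rintro _ ⟨i', d', c', p', b, h1, h2, hb, h3, h4, h5, rfl⟩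
  exact ⟨i', i' + d', p', b, h1, by omega, by omega, hb, h3, h4, h5,
    by rw [← h2, alpha_eq hk hq0 h1]⟩
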